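/- arXiv:1506.01234 — 2 statements merged into one kernel-verified Lean document; each statement's English description precedes it below -/
import Mathlib

section
/- For every affine homeomorphism φ (an affine map of ℝ² with invertible linear part) defined on an open square Q₀ ⊂ ℝ² with edges parallel to the coordinate axes, and for every n ∈ ℕ with n ≥ 1, there exist a piecewise affine homeomorphism φ_n : Q₀ → φ(Q₀) whose continuous extension agrees with that of φ on ∂Q₀ and which satisfies |Var(φ_n,Q₀) − Var(φ,Q₀)| ≤ (1/n)·Var(φ,Q₀), and a set F_n ⊆ Q₀, a finite union of pairwise disjoint open triangles, such that |F_n| < |Q₀|/n and Var(φ_n, F_n) > (1/2 − 1/n)·Var(φ, Q₀). -/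
open MeasureTheory Set
open scoped ENNReal

noncomputable section

abbrev Plane := EuclideanSpace ℝ (Fin 2)

/-- The open unit square `(0,1)²`. -/
def unitSq : Set Plane := {x | 0 < x 0 ∧ x 0 < 1 ∧ 0 < x 1 ∧ x 1 < 1}

/-- Standard basis vectors of the plane. -/
def e2 (i : Fin 2) : Plane := EuclideanSpace.single i 1

/-- The set of approximating values in the definition of the variation of `f` on `U`:
integrals against `C¹_c` test fields `φ = (φ₁, φ₂)` all of whose four components are
bounded by `1` in absolute value. -/
def varSet (f : Plane → Plane) (U : Set Plane) : Set ℝ :=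
  {v | ∃ φ : Plane → Plane × Plane,
    ContDiff ℝ 1 φ ∧ HasCompactSupport φ ∧ tsupport φ ⊆ U ∧
    (∀ x i, |(φ x).1 i| ≤ 1 ∧ |(φ x).2 i| ≤ 1) ∧
    v = ∫ x in U, ((f x 0) * (fderiv ℝ (fun y => (φ y).1 0) x (e2 0)
                    + fderiv ℝ (fun y => (φ y).1 1) x (e2 1))
        + (f x 1) * (fderiv ℝ (fun y => (φ y).2 0) x (e2 0)
                    + fderiv ℝ (fun y => (φ y).2 1) x (e2 1)))}

/-- The variation of `f` in `U`. -/
def Var (f : Plane → Plane) (U : Set Plane) : ℝ := sSup (varSet f U)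

/-- `f` is a `BV` map on `U`. -/
def IsBV (f : Plane → Plane) (U : Set Plane) : Prop :=
  IntegrableOn f U volume ∧ BddAbove (varSet f U)

/-- `f` is a homeomorphism of `U` onto `V`, with inverse `g`. -/
def IsHomeoOn (f g : Plane → Plane) (U V : Set Plane) : Prop :=
  BijOn f U V ∧ ContinuousOn f U ∧ InvOn g f U V ∧ ContinuousOn g V

/-- `f` (as a total function, representing its own continuous extension) extends
continuously to the closure of the unit square, with `f = Id` on the boundary. -/
def ExtendsToId (f : Plane → Plane) : Prop :=
  ContinuousOn f (closure unitSq) ∧ EqOn f id (frontier unitSq)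

/-- The space `X` of `BV` homeomorphisms of the unit square fixing the boundary with
variation smaller than `M`; an element is a pair (homeomorphism, inverse). -/
def X (M : ℝ) : Set ((Plane → Plane) × (Plane → Plane)) :=
  {p | IsHomeoOn p.1 p.2 unitSq unitSq ∧ ExtendsToId p.1 ∧
    IsBV p.1 unitSq ∧ Var p.1 unitSq < M}

/-- Sup distance `‖f - g‖_∞` over the set `U`. -/
def supDist (f g : Plane → Plane) (U : Set Plane) : ℝ := ⨆ x : U, dist (f x) (g x)

/-- The distance `d` on `X`. -/
def dX (M : ℝ) (p q : (Plane → Plane) × (Plane → Plane)) : ℝ :=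
  supDist p.1 q.1 unitSq + supDist p.2 q.2 unitSq +
    |1 / (M - Var p.1 unitSq) - 1 / (M - Var q.1 unitSq)|

/-- `A` is open in the metric space `(X, d)`. -/
def OpenInX (M : ℝ) (A : Set ((Plane → Plane) × (Plane → Plane))) : Prop :=
  A ⊆ X M ∧ ∀ p ∈ A, ∃ ε > 0, ∀ q ∈ X M, dX M p q < ε → q ∈ A

/-- `A` is dense in the metric space `(X, d)`. -/
def DenseInX (M : ℝ) (A : Set ((Plane → Plane) × (Plane → Plane))) : Prop :=
  A ⊆ X M ∧ ∀ p ∈ X M, ∀ ε > 0, ∃ q ∈ A, dX M p q < ε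

/-- An open triangle in the plane. -/
def IsOpenTriangle (T : Set Plane) : Prop :=
  ∃ a b c : Plane, T = interior (convexHull ℝ {a, b, c})

/-- A finite union of pairwise disjoint open triangles. -/
def FinUnionTriangles (E : Set Plane) : Prop :=
  ∃ (k : ℕ) (T : Fin k → Set Plane), (∀ i, IsOpenTriangle (T i)) ∧
    (∀ i j, i ≠ j → Disjoint (T i) (T j)) ∧ E = ⋃ i, T i

/-- The set `A` of homeomorphisms mapping a null set onto a set of full measure. -/
def Afull (M : ℝ) : Set ((Plane → Plane) × (Plane → Plane)) :=
  {p ∈ X M | ∃ E ⊆ unitSq, volume E = 0 ∧ volume (p.1 '' E) = 1}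

/-- The set `A_n`. -/
def An (M : ℝ) (n : ℕ) : Set ((Plane → Plane) × (Plane → Plane)) :=
  {p ∈ X M | ∃ E ⊆ unitSq, FinUnionTriangles E ∧
    volume E < 1 / (n : ℝ≥0∞) ∧ 1 - 1 / (n : ℝ≥0∞) < volume (p.1 '' E)}

/-- An open square with edges parallel to the coordinate axes. -/
def IsOpenAxisSquare (Q0 : Set Plane) : Prop :=
  ∃ a b s : ℝ, 0 < s ∧
    Q0 = {x | a < x 0 ∧ x 0 < a + s ∧ b < x 1 ∧ x 1 < b + s}

/-- A closed triangle in the plane. -/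
def IsClosedTriangle (T : Set Plane) : Prop :=
  ∃ a b c : Plane, T = convexHull ℝ {a, b, c}

/-- `h` is (finitely) piecewise affine on the open square `Q0`: there is a finite family
of closed triangles with pairwise disjoint interiors covering the closure of `Q0`, with
`h` affine on (the intersection of `Q0` with) each of them. -/
def PiecewiseAffineOn (h : Plane → Plane) (Q0 : Set Plane) : Prop :=
  ∃ (k : ℕ) (T : Fin k → Set Plane), (∀ i, IsClosedTriangle (T i)) ∧
    (∀ i j, i ≠ j → Disjoint (interior (T i)) (interior (T j))) ∧
    (⋃ i, T i) = closure Q0 ∧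
    ∀ i, ∃ A : Plane →ᵃ[ℝ] Plane, EqOn h (⇑A) (Q0 ∩ T i)

/-! ### Variation of Lipschitz maps -/

lemma setIntegral_mul_fderiv_eq {f g : Plane → ℝ} {K : NNReal} (hf : LipschitzWith K f)
    (hg : ContDiff ℝ 1 g) (hc : HasCompactSupport g) {U : Set Plane} (hU : tsupport g ⊆ U)
    (v : Plane) :
    ∫ x in U, f x * fderiv ℝ g x v = - ∫ x in U, lineDeriv ℝ f x v * g x := by
  obtain ⟨D, hD⟩ := ContDiff.lipschitzWith_of_hasCompactSupport hc hg one_ne_zero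
  have hd : Differentiable ℝ g := hg.differentiable one_ne_zero
  have h1 := hf.integral_lineDeriv_mul_eq (μ := volume) hD hc v
  have z1 : ∀ x, x ∉ U → g x = 0 := fun x hx => image_eq_zero_of_notMem_tsupport fun h => hx (hU h)
  have z2 : ∀ x, x ∉ U → fderiv ℝ g x v = 0 := fun x hx => by
    have : x ∉ tsupport (fderiv ℝ g) := fun h => hx (hU (tsupport_fderiv_subset ℝ h))
    simp [image_eq_zero_of_notMem_tsupport this]
  rw [setIntegral_eq_integral_of_forall_compl_eq_zero (fun x hx => by simp [z2 x hx]),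
    setIntegral_eq_integral_of_forall_compl_eq_zero (fun x hx => by simp [z1 x hx]), h1,
    ← integral_neg]
  refine integral_congr_ae (Filter.Eventually.of_forall fun x => ?_)
  simp only [(hd x).lineDeriv_eq_fderiv, map_neg]
  ring

lemma integrableOn_mul_fderiv {f g : Plane → ℝ} (hf : Continuous f)
    (hg : ContDiff ℝ 1 g) (hc : HasCompactSupport g) (U : Set Plane) (v : Plane) :
    IntegrableOn (fun x => f x * fderiv ℝ g x v) U := by
  have hcont : Continuous fun x => fderiv ℝ g x v :=
    (hg.continuous_fderiv one_ne_zero).clm_apply continuous_const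
  have hs : HasCompactSupport fun x => fderiv ℝ g x v :=
    (hc.fderiv (𝕜 := ℝ)).comp_left (g := fun l : Plane →L[ℝ] ℝ => l v) (by simp)
  exact ((hf.mul hcont).integrable_of_hasCompactSupport hs.mul_left).integrableOn

lemma integrableOn_lineDeriv {f : Plane → ℝ} {K : NNReal} (hf : LipschitzWith K f)
    {U : Set Plane} (hU : volume U ≠ ∞) (v : Plane) :
    IntegrableOn (fun x => lineDeriv ℝ f x v) U := by
  have : IsFiniteMeasure (volume.restrict U) := ⟨by simpa using hU.lt_top⟩
  exact Integrable.of_bound (measurable_lineDeriv hf.continuous).aestronglyMeasurable (K * ‖v‖)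
    (Filter.Eventually.of_forall fun x => norm_lineDeriv_le_of_lipschitz ℝ hf)

lemma integrableOn_lineDeriv_mul {f g : Plane → ℝ} {K : NNReal} (hf : LipschitzWith K f)
    (hg : Continuous g) (hb : ∀ x, |g x| ≤ 1) {U : Set Plane} (hU : volume U ≠ ∞) (v : Plane) :
    IntegrableOn (fun x => lineDeriv ℝ f x v * g x) U :=
  (integrableOn_lineDeriv hf hU v).mul_bdd (c := 1) hg.aestronglyMeasurable
    (Filter.Eventually.of_forall fun x => by simpa using hb x)

/-- The component `(i, j)` of a test field. -/
def testComp (φ : Plane → Plane × Plane) : Fin 2 → Fin 2 → Plane → ℝ :=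
  ![fun j x => (φ x).1 j, fun j x => (φ x).2 j]

lemma contDiff_testComp {φ : Plane → Plane × Plane} (h : ContDiff ℝ 1 φ) (i j : Fin 2) :
    ContDiff ℝ 1 (testComp φ i j) := by
  have h1 : ContDiff ℝ 1 fun x => (φ x).1 := contDiff_fst.comp h
  have h2 : ContDiff ℝ 1 fun x => (φ x).2 := contDiff_snd.comp h
  fin_cases i
  · exact (contDiff_euclidean.1 h1) j
  · exact (contDiff_euclidean.1 h2) j

lemma tsupport_testComp_subset (φ : Plane → Plane × Plane) (i j : Fin 2) :
    tsupport (testComp φ i j) ⊆ tsupport φ := by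
  refine closure_mono fun x hx => ?_
  rw [Function.mem_support] at hx ⊢
  contrapose! hx
  fin_cases i <;> simp [testComp, hx]

lemma abs_testComp_le {φ : Plane → Plane × Plane}
    (h : ∀ x i, |(φ x).1 i| ≤ 1 ∧ |(φ x).2 i| ≤ 1) (i j : Fin 2) (x : Plane) :
    |testComp φ i j x| ≤ 1 := by
  fin_cases i
  exacts [(h x j).1, (h x j).2]

/-- The value of a test field against a Lipschitz map, after integration by parts. -/
lemma test_integral_eq {f : Plane → Plane} {K : NNReal}
    (hf : ∀ i, LipschitzWith K fun x => f x i) {U : Set Plane} {φ : Plane → Plane × Plane}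
    (h1 : ContDiff ℝ 1 φ) (h2 : HasCompactSupport φ) (h3 : tsupport φ ⊆ U) :
    ∫ x in U, ((f x 0) * (fderiv ℝ (fun y => (φ y).1 0) x (e2 0)
                    + fderiv ℝ (fun y => (φ y).1 1) x (e2 1))
        + (f x 1) * (fderiv ℝ (fun y => (φ y).2 0) x (e2 0)
                    + fderiv ℝ (fun y => (φ y).2 1) x (e2 1)))
      = ∑ i, ∑ j, - ∫ x in U, lineDeriv ℝ (fun y => f y i) x (e2 j) * testComp φ i j x := by
  have hc : ∀ i j, HasCompactSupport (testComp φ i j) := fun i j =>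
    h2.of_isClosed_subset (isClosed_tsupport _) (tsupport_testComp_subset φ i j)
  have hI : ∀ i j, IntegrableOn (fun x => f x i * fderiv ℝ (testComp φ i j) x (e2 j)) U :=
    fun i j => integrableOn_mul_fderiv (hf i).continuous (contDiff_testComp h1 i j) (hc i j) U _
  have hE : ∀ i j, - ∫ x in U, lineDeriv ℝ (fun y => f y i) x (e2 j) * testComp φ i j x
      = ∫ x in U, f x i * fderiv ℝ (testComp φ i j) x (e2 j) := fun i j =>
    (setIntegral_mul_fderiv_eq (hf i) (contDiff_testComp h1 i j) (hc i j)
      ((tsupport_testComp_subset φ i j).trans h3) _).symm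
  simp only [hE, Fin.sum_univ_two]
  rw [← integral_add (hI 0 0) (hI 0 1), ← integral_add (hI 1 0) (hI 1 1)]
  refine Eq.trans ?_ (integral_add (Integrable.add (hI 0 0) (hI 0 1))
      (Integrable.add (hI 1 0) (hI 1 1)))
  refine integral_congr_ae (Filter.Eventually.of_forall fun x => ?_)
  simp only [testComp, Matrix.cons_val_zero, Matrix.cons_val_one]
  ring

lemma le_of_mem_varSet {f : Plane → Plane} {K : NNReal}
    (hf : ∀ i, LipschitzWith K fun x => f x i) {U : Set Plane} (hU : volume U ≠ ∞)
    {v : ℝ} (hv : v ∈ varSet f U) :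
    v ≤ ∑ i, ∑ j, ∫ x in U, |lineDeriv ℝ (fun y => f y i) x (e2 j)| := by
  obtain ⟨φ, h1, h2, h3, h4, rfl⟩ := hv
  rw [test_integral_eq hf h1 h2 h3]
  refine Finset.sum_le_sum fun i _ => Finset.sum_le_sum fun j _ => ?_
  rw [← integral_neg]
  have hT : Continuous (testComp φ i j) := (contDiff_testComp h1 i j).continuous
  refine integral_mono (integrableOn_lineDeriv_mul (hf i) hT (abs_testComp_le h4 i j) hU _).neg
    (integrableOn_lineDeriv (hf i) hU _).abs fun x => ?_
  refine (neg_le_abs _).trans ?_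
  rw [abs_mul]
  exact mul_le_of_le_one_right (abs_nonneg _) (abs_testComp_le h4 i j x)

lemma Var_le {f : Plane → Plane} {K : NNReal}
    (hf : ∀ i, LipschitzWith K fun x => f x i) {U : Set Plane} (hU : volume U ≠ ∞) :
    Var f U ≤ ∑ i, ∑ j, ∫ x in U, |lineDeriv ℝ (fun y => f y i) x (e2 j)| := by
  refine Real.sSup_le (fun v hv => le_of_mem_varSet hf hU hv) ?_
  exact Finset.sum_nonneg fun i _ => Finset.sum_nonneg fun j _ =>
    integral_nonneg fun x => abs_nonneg _

lemma exists_cutoff {U K : Set Plane} (hU : IsOpen U) (hK : IsCompact K) (hKU : K ⊆ U) :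
    ∃ χ : Plane → ℝ, ContDiff ℝ 1 χ ∧ HasCompactSupport χ ∧ tsupport χ ⊆ U ∧
      (∀ x, 0 ≤ χ x ∧ χ x ≤ 1) ∧ ∀ x ∈ K, χ x = 1 := by
  obtain ⟨L, hL, hKL, hLU⟩ := exists_compact_between hK hU hKU
  obtain ⟨χ, h1, h0, h01⟩ := exists_contMDiffMap_one_nhds_of_subset_interior (n := 1)
    (modelWithCornersSelf ℝ Plane) hK.isClosed hKL
  have hs : tsupport χ ⊆ L := closure_minimal (fun x hx => by
    by_contra h
    exact hx (h0 x h)) hL.isClosed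
  exact ⟨χ, χ.contMDiff.contDiff, hL.of_isClosed_subset (isClosed_tsupport _) hs, hs.trans hLU,
    fun x => h01 x, fun x hx => h1.self_of_nhdsSet x hx⟩

/-- Testing with an approximation of the constant field `-σ` on `U`. -/
lemma sum_integral_lineDeriv_le_Var {f : Plane → Plane} {K : NNReal}
    (hf : ∀ i, LipschitzWith K fun x => f x i) {U : Set Plane} (hU : volume U ≠ ∞)
    (hUo : IsOpen U) (σ : Fin 2 → Fin 2 → ℝ) (hσ : ∀ i j, |σ i j| ≤ 1) :
    ∑ i, ∑ j, σ i j * ∫ x in U, lineDeriv ℝ (fun y => f y i) x (e2 j) ≤ Var f U := by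
  refine le_of_forall_pos_le_add fun ε hε => ?_
  set δ : ℝ := ε / (4 * (K + 1)) with hδ
  have hδ0 : 0 < δ := by positivity
  obtain ⟨C, hCU, hC, hCε⟩ := hUo.measurableSet.exists_isCompact_sdiff_lt hU
    (ε := ENNReal.ofReal δ) (by simpa using hδ0)
  obtain ⟨χ, hχ, hχc, hχU, hχ1, hχK⟩ := exists_cutoff hUo hC hCU
  have hχb : ∀ x, |χ x| ≤ 1 := fun x => abs_le.2 ⟨by linarith [hχ1 x], (hχ1 x).2⟩
  set φ : Plane → Plane × Plane := fun x =>
    (WithLp.toLp 2 fun j => -σ 0 j * χ x, WithLp.toLp 2 fun j => -σ 1 j * χ x) with hφ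
  have hφσ : ∀ i j x, testComp φ i j x = -σ i j * χ x := by
    intro i j x
    fin_cases i <;> simp [testComp, hφ]
  have h1 : ContDiff ℝ 1 φ := by
    refine ContDiff.prodMk ?_ ?_ <;>
    exact contDiff_euclidean.2 fun j => contDiff_const.mul hχ
  have hsup : Function.support φ ⊆ Function.support χ := fun x hx => by
    rw [Function.mem_support] at hx ⊢
    contrapose! hx
    simp [hφ, hx]
    rfl
  have hts : tsupport φ ⊆ tsupport χ := closure_mono hsup
  have h2 : HasCompactSupport φ := hχc.of_isClosed_subset (isClosed_tsupport _) hts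
  have hb : ∀ i j x, |-σ i j * χ x| ≤ 1 := fun i j x => by
    rw [abs_mul, abs_neg]
    exact mul_le_one₀ (hσ i j) (abs_nonneg _) (hχb x)
  have hmem := (show _ ∈ varSet f U from
    ⟨φ, h1, h2, hts.trans hχU, fun x i => ⟨hb 0 i x, hb 1 i x⟩, rfl⟩)
  have hle := le_csSup ⟨_, fun v hv => le_of_mem_varSet hf hU hv⟩ hmem
  rw [test_integral_eq hf h1 h2 (hts.trans hχU)] at hle
  have hterm : ∀ i j, σ i j * ∫ x in U, lineDeriv ℝ (fun y => f y i) x (e2 j) ≤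
      (- ∫ x in U, lineDeriv ℝ (fun y => f y i) x (e2 j) * testComp φ i j x) + ε / 4 := by
    intro i j
    simp only [hφσ]
    have hI1 := (integrableOn_lineDeriv (hf i) hU (e2 j)).const_mul (σ i j)
    have hI2 := integrableOn_lineDeriv_mul (hf i) (g := fun x => -σ i j * χ x)
      (continuous_const.mul hχ.continuous) (hb i j) hU (e2 j)
    have hI3 : IntegrableOn ((U \ C).indicator fun _ => (K : ℝ)) U :=
      ((integrableOn_const (C := (K : ℝ)) hU).indicator
        (hUo.measurableSet.diff hC.measurableSet))
    rw [← sub_le_iff_le_add', sub_neg_eq_add, ← integral_const_mul, ← integral_add hI1 hI2]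
    calc _ ≤ ∫ x in U, (U \ C).indicator (fun _ => (K : ℝ)) x := by
            refine integral_mono_ae (hI1.add hI2) hI3 ?_
            filter_upwards [ae_restrict_mem hUo.measurableSet] with x hx
            by_cases hxC : x ∈ C
            · simp [hxC, hχK x hxC, mul_comm]
            · rw [indicator_of_mem (show x ∈ U \ C from ⟨hx, hxC⟩)]
              have hl : |lineDeriv ℝ (fun y => f y i) x (e2 j)| ≤ K := by
                simpa [e2] using
                  norm_lineDeriv_le_of_lipschitz ℝ (x₀ := x) (v := e2 j) (hf i)
              calc σ i j * lineDeriv ℝ (fun y => f y i) x (e2 j) +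
                    lineDeriv ℝ (fun y => f y i) x (e2 j) * (-σ i j * χ x)
                  = σ i j * (1 - χ x) * lineDeriv ℝ (fun y => f y i) x (e2 j) := by ring
                _ ≤ |σ i j| * |1 - χ x| * |lineDeriv ℝ (fun y => f y i) x (e2 j)| := by
                  rw [← abs_mul, ← abs_mul]; exact le_abs_self _
                _ ≤ 1 * 1 * K := by
                  gcongr
                  · exact hσ i j
                  · exact abs_le.2 ⟨by linarith [(hχ1 x).2], by linarith [(hχ1 x).1]⟩
                _ = K := by ring
      _ = volume.real (U \ C) * K := by
            rw [setIntegral_indicator (hUo.measurableSet.diff hC.measurableSet)]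
            simp [inter_eq_self_of_subset_right (sdiff_subset : U \ C ⊆ U)]
      _ ≤ δ * (K + 1) := by
            gcongr
            · exact ENNReal.toReal_le_of_le_ofReal hδ0.le hCε.le
            · linarith
      _ = ε / 4 := by rw [hδ]; field_simp
  calc _ ≤ ∑ i, ∑ j, ((- ∫ x in U, lineDeriv ℝ (fun y => f y i) x (e2 j) * testComp φ i j x)
          + ε / 4) := Finset.sum_le_sum fun i _ => Finset.sum_le_sum fun j _ => hterm i j
    _ = (∑ i, ∑ j, - ∫ x in U, lineDeriv ℝ (fun y => f y i) x (e2 j) * testComp φ i j x)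
          + ε := by
        simp only [Fin.sum_univ_two]; ring
    _ ≤ _ := by gcongr; exact hle

/-! ### Coordinates and triangles -/

/-- The point with `i`-th coordinate `t` and `j`-th coordinate `y`. -/
def pt (i j : Fin 2) (t y : ℝ) : Plane := t • e2 i + y • e2 j

lemma e2_self (i : Fin 2) : e2 i i = 1 := by simp [e2]

lemma e2_of_ne {i j : Fin 2} (h : i ≠ j) : e2 i j = 0 := by simp [e2, h.symm]

lemma pt_fst {i j : Fin 2} (hij : i ≠ j) (t y : ℝ) : pt i j t y i = t := by
  simp [pt, e2_self, e2_of_ne hij.symm]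

lemma pt_snd {i j : Fin 2} (hij : i ≠ j) (t y : ℝ) : pt i j t y j = y := by
  simp [pt, e2_self, e2_of_ne hij]

lemma eq_or_eq_of_ne {i j : Fin 2} (hij : i ≠ j) (k : Fin 2) : k = i ∨ k = j := by omega

lemma plane_ext {i j : Fin 2} (hij : i ≠ j) {x y : Plane} (h1 : x i = y i) (h2 : x j = y j) :
    x = y := by
  ext k
  rcases eq_or_eq_of_ne hij k with rfl | rfl
  exacts [h1, h2]

lemma exists_pos_add_smul_mem {S : Set Plane} {x : Plane} (hx : x ∈ interior S) (v : Plane) :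
    ∃ t : ℝ, 0 < t ∧ x + t • v ∈ S := by
  have hc : Continuous fun t : ℝ => x + t • v := by fun_prop
  have h0 : ∀ᶠ t in nhds (0 : ℝ), x + t • v ∈ S :=
    hc.continuousAt.eventually (by simpa using mem_interior_iff_mem_nhds.1 hx)
  obtain ⟨t, ht, ht'⟩ :=
    ((h0.filter_mono nhdsWithin_le_nhds).and (self_mem_nhdsWithin (s := Ioi (0 : ℝ)))).exists
  exact ⟨t, ht', ht⟩

/-- A functional with unit slope in some direction, nonnegative on `S`, is positive inside. -/
lemma pos_of_mem_interior {S : Set Plane} {f : Plane → ℝ} {v : Plane}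
    (hf : ∀ x t, f (x + t • v) = f x + t) (hS : ∀ x ∈ S, 0 ≤ f x) {x : Plane}
    (hx : x ∈ interior S) : 0 < f x := by
  obtain ⟨t, ht, hxt⟩ := exists_pos_add_smul_mem hx (-v)
  have h1 := hS _ hxt
  have h2 := hf x (-t)
  rw [smul_neg, ← neg_smul, h2] at h1
  linarith

lemma neg_of_mem_interior {S : Set Plane} {f : Plane → ℝ} {v : Plane}
    (hf : ∀ x t, f (x + t • v) = f x + t) (hS : ∀ x ∈ S, f x ≤ 0) {x : Plane}
    (hx : x ∈ interior S) : f x < 0 := by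
  obtain ⟨t, ht, hxt⟩ := exists_pos_add_smul_mem hx v
  have h1 := hS _ hxt
  rw [hf x t] at h1
  linarith

lemma disjoint_interior {S S' : Set Plane} {f : Plane → ℝ} {v : Plane}
    (hf : ∀ x t, f (x + t • v) = f x + t) (hS : ∀ x ∈ S, f x ≤ 0) (hS' : ∀ x ∈ S', 0 ≤ f x) :
    Disjoint (interior S) (interior S') :=
  disjoint_left.2 fun _ h h' =>
    (neg_of_mem_interior hf hS h).not_gt (pos_of_mem_interior hf hS' h')

/-- The relative position of `t` on the segment from `t0` to `t1`. -/
def rel (t0 t1 t : ℝ) : ℝ := (t - t0) / (t1 - t0)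

lemma rel_symm {t0 t1 : ℝ} (h : t0 ≠ t1) (t : ℝ) : rel t1 t0 t = 1 - rel t0 t1 t := by
  have h1 : t1 - t0 ≠ 0 := sub_ne_zero.2 h.symm
  have h2 : t0 - t1 ≠ 0 := sub_ne_zero.2 h
  unfold rel
  field_simp
  ring

/-- The closed triangle with one vertex on the line `x i = t0` and two on `x i = t1`. -/
def tri (i j : Fin 2) (t0 t1 g p q : ℝ) : Set Plane :=
  convexHull ℝ {pt i j t0 g, pt i j t1 p, pt i j t1 q}

lemma isClosedTriangle_tri (i j : Fin 2) (t0 t1 g p q : ℝ) :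
    IsClosedTriangle (tri i j t0 t1 g p q) := ⟨_, _, _, rfl⟩

lemma mem_tri {i j : Fin 2} (hij : i ≠ j) {t0 t1 g p q : ℝ} (ht : t0 ≠ t1) (hpq : p < q)
    (x : Plane) : x ∈ tri i j t0 t1 g p q ↔
      (0 ≤ rel t0 t1 (x i) ∧ rel t0 t1 (x i) ≤ 1) ∧
      g + (p - g) * rel t0 t1 (x i) ≤ x j ∧ x j ≤ g + (q - g) * rel t0 t1 (x i) := by
  have h1 : t1 - t0 ≠ 0 := sub_ne_zero.2 ht.symm
  have hqp : 0 < q - p := sub_pos.2 hpq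
  have hx : x i = t0 + rel t0 t1 (x i) * (t1 - t0) := by unfold rel; field_simp; ring
  rw [tri, convexHull_insert (insert_nonempty _ _), convexHull_pair, convexJoin_singleton_left]
  simp only [mem_iUnion, segment, mem_ofPred_eq, exists_prop]
  constructor
  · rintro ⟨z, ⟨c, d, hc, hd, hcd, rfl⟩, a, b, ha, hb, hab, rfl⟩
    have e : rel t0 t1 ((a • pt i j t0 g + b • (c • pt i j t1 p + d • pt i j t1 q)) i) = b := by
      simp only [PiLp.add_apply, PiLp.smul_apply, pt_fst hij, smul_eq_mul, rel]
      rw [div_eq_iff h1, show a = 1 - b by linarith, show c = 1 - d by linarith]; ring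
    rw [e]
    simp only [PiLp.add_apply, PiLp.smul_apply, pt_snd hij, smul_eq_mul]
    rw [show a = 1 - b by linarith, show c = 1 - d by linarith]
    refine ⟨⟨hb, by linarith⟩, ?_, ?_⟩
    · nlinarith [mul_nonneg (mul_nonneg hb hd) hqp.le]
    · nlinarith [mul_nonneg (mul_nonneg hb (show 0 ≤ 1 - d by linarith)) hqp.le]
  · set τ := rel t0 t1 (x i)
    rintro ⟨⟨h0, h1⟩, h2, h3⟩
    rcases h0.eq_or_lt with h0 | h0
    · refine ⟨pt i j t1 p, ⟨1, 0, by simp⟩, 1, 0, by simp, by simp, by simp,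
        plane_ext hij ?_ ?_⟩
      · rw [hx]; simp [pt_fst hij, ← h0]
      · rw [← h0] at h2 h3
        simp only [PiLp.add_apply, PiLp.smul_apply, pt_snd hij, smul_eq_mul]
        linarith
    · set μ := (x j - (g + (p - g) * τ)) / (τ * (q - p)) with hμ
      have hμe : μ * (τ * (q - p)) = x j - (g + (p - g) * τ) := by rw [hμ]; field_simp
      have hτq : 0 < τ * (q - p) := by positivity
      refine ⟨(1 - μ) • pt i j t1 p + μ • pt i j t1 q, ⟨1 - μ, μ, ?_, ?_, by ring, rfl⟩,
        1 - τ, τ, by linarith, h0.le, by ring, plane_ext hij ?_ ?_⟩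
      · rw [sub_nonneg, hμ, div_le_one hτq]; linarith
      · exact div_nonneg (by linarith) hτq.le
      · rw [hx]
        simp only [PiLp.add_apply, PiLp.smul_apply, pt_fst hij, smul_eq_mul]; ring
      · simp only [PiLp.add_apply, PiLp.smul_apply, pt_snd hij, smul_eq_mul]
        linear_combination hμe

/-! ### Triangulations -/

/-- `h` is affine on each triangle of some finite triangulation of `S`. -/
def Triangulated (h : Plane → Plane) (S : Set Plane) : Prop :=
  ∃ (k : ℕ) (T : Fin k → Set Plane), (∀ i, IsClosedTriangle (T i)) ∧
    (∀ i j, i ≠ j → Disjoint (interior (T i)) (interior (T j))) ∧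
    (⋃ i, T i) = S ∧ ∀ i, ∃ A : Plane →ᵃ[ℝ] Plane, EqOn h (⇑A) (T i)

lemma Triangulated.of_triangle {h : Plane → Plane} {S : Set Plane} (hS : IsClosedTriangle S)
    (A : Plane →ᵃ[ℝ] Plane) (hA : EqOn h A S) : Triangulated h S :=
  ⟨1, fun _ => S, fun _ => hS, fun i j hij => (hij (Subsingleton.elim _ _)).elim,
    by simp [iUnion_const], fun _ => ⟨A, hA⟩⟩

lemma iUnion_append {k k' : ℕ} (T : Fin k → Set Plane) (T' : Fin k' → Set Plane) :
    ⋃ i, Fin.append T T' i = (⋃ i, T i) ∪ ⋃ i, T' i := by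
  ext x
  simp only [mem_iUnion, mem_union]
  constructor
  · rintro ⟨i, hi⟩
    induction i using Fin.addCases with
    | left a => exact Or.inl ⟨a, by simpa using hi⟩
    | right a => exact Or.inr ⟨a, by simpa using hi⟩
  · rintro (⟨a, ha⟩ | ⟨a, ha⟩)
    · exact ⟨Fin.castAdd k' a, by simpa using ha⟩
    · exact ⟨Fin.natAdd k a, by simpa using ha⟩

lemma disjoint_append {k k' : ℕ} {T : Fin k → Set Plane} {T' : Fin k' → Set Plane}
    (F : Set Plane → Set Plane) (h : ∀ i j, i ≠ j → Disjoint (F (T i)) (F (T j)))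
    (h' : ∀ i j, i ≠ j → Disjoint (F (T' i)) (F (T' j)))
    (hcross : ∀ a b, Disjoint (F (T a)) (F (T' b))) (i j : Fin (k + k')) (hij : i ≠ j) :
    Disjoint (F (Fin.append T T' i)) (F (Fin.append T T' j)) := by
  induction i using Fin.addCases with
  | left a => induction j using Fin.addCases with
    | left b => simpa using h a b fun e => hij (by rw [e])
    | right b => simpa using hcross a b
  | right a => induction j using Fin.addCases with
    | left b => simpa using (hcross b a).symm
    | right b => simpa using h' a b fun e => hij (by rw [e])

lemma Triangulated.union {h : Plane → Plane} {S S' : Set Plane} (hS : Triangulated h S)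
    (hS' : Triangulated h S') (hd : Disjoint (interior S) (interior S')) :
    Triangulated h (S ∪ S') := by
  obtain ⟨k, T, h1, h2, rfl, h4⟩ := hS
  obtain ⟨k', T', h1', h2', rfl, h4'⟩ := hS'
  refine ⟨k + k', Fin.append T T', fun i => ?_, disjoint_append interior h2 h2' fun a b =>
    hd.mono (interior_mono (subset_iUnion _ _)) (interior_mono (subset_iUnion _ _)),
    iUnion_append T T', fun i => ?_⟩
  · induction i using Fin.addCases <;> simp [h1, h1']
  · induction i using Fin.addCases with
    | left a => simpa using h4 a
    | right a => simpa using h4' a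

lemma FinUnionTriangles.empty : FinUnionTriangles ∅ :=
  ⟨0, fun _ => ∅, fun i => i.elim0, fun i => i.elim0, by simp⟩

lemma FinUnionTriangles.of_triangle {S : Set Plane} (hS : IsOpenTriangle S) :
    FinUnionTriangles S :=
  ⟨1, fun _ => S, fun _ => hS, fun i j hij => (hij (Subsingleton.elim _ _)).elim,
    by simp [iUnion_const]⟩

lemma FinUnionTriangles.union {S S' : Set Plane} (hS : FinUnionTriangles S)
    (hS' : FinUnionTriangles S') (hd : Disjoint S S') : FinUnionTriangles (S ∪ S') := by
  obtain ⟨k, T, h1, h2, rfl⟩ := hS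
  obtain ⟨k', T', h1', h2', rfl⟩ := hS'
  refine ⟨k + k', Fin.append T T', fun i => ?_, disjoint_append id h2 h2' fun a b =>
    hd.mono (subset_iUnion T a) (subset_iUnion T' b), (iUnion_append T T').symm⟩
  induction i using Fin.addCases <;> simp [h1, h1']

/-! ### One column -/

lemma exists_affineMap (P : Plane →ᵃ[ℝ] Plane) (i j : Fin 2) (α β γ : ℝ) :
    ∃ A : Plane →ᵃ[ℝ] Plane, ∀ x, A x = P (x + (α + β * x i + γ * x j) • e2 i) := by
  let l : Plane →ₗ[ℝ] ℝ :=
    β • (EuclideanSpace.proj (𝕜 := ℝ) i : Plane →L[ℝ] ℝ).toLinearMap +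
      γ • (EuclideanSpace.proj (𝕜 := ℝ) j : Plane →L[ℝ] ℝ).toLinearMap
  refine ⟨P.comp ((LinearMap.id + l.smulRight (e2 i)).toAffineMap +
    AffineMap.const ℝ Plane (α • e2 i)), fun x => ?_⟩
  simp only [AffineMap.comp_apply, AffineMap.const_apply, Pi.add_apply,
    LinearMap.coe_toAffineMap, LinearMap.add_apply, LinearMap.id_apply, LinearMap.smulRight_apply,
    AffineMap.coe_add]
  congr 1
  simp only [l, LinearMap.add_apply, LinearMap.smul_apply, smul_eq_mul]
  change x + (β * x i + γ * x j) • e2 i + α • e2 i = _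
  module

/-- The closed column over the segment from `t0` to `t1`. -/
def col (i j : Fin 2) (t0 t1 b s : ℝ) : Set Plane :=
  {x | (0 ≤ rel t0 t1 (x i) ∧ rel t0 t1 (x i) ≤ 1) ∧ b ≤ x j ∧ x j ≤ b + s}

/-- The lower of the two triangles of a column on which the profile only depends on `x i`. -/
def loTri (i j : Fin 2) (t0 t1 b s H : ℝ) : Set Plane := tri i j t0 t1 b (b + H) (b + s - H)

/-- The upper of the two triangles of a column on which the profile only depends on `x i`. -/
def upTri (i j : Fin 2) (t0 t1 b s H : ℝ) : Set Plane := tri i j t1 t0 (b + s - H) b (b + s)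

lemma mem_loTri {i j : Fin 2} (hij : i ≠ j) {t0 t1 b s H : ℝ} (ht : t0 ≠ t1) (hH : 2 * H < s)
    (x : Plane) : x ∈ loTri i j t0 t1 b s H ↔
      (0 ≤ rel t0 t1 (x i) ∧ rel t0 t1 (x i) ≤ 1) ∧
      b + H * rel t0 t1 (x i) ≤ x j ∧ x j ≤ b + (s - H) * rel t0 t1 (x i) := by
  rw [loTri, mem_tri hij ht (by linarith), show b + H - b = H by ring,
    show b + s - H - b = s - H by ring]

lemma mem_upTri {i j : Fin 2} (hij : i ≠ j) {t0 t1 b s H : ℝ} (ht : t0 ≠ t1) (hs : 0 < s)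
    (x : Plane) : x ∈ upTri i j t0 t1 b s H ↔
      (0 ≤ rel t0 t1 (x i) ∧ rel t0 t1 (x i) ≤ 1) ∧
      b + (s - H) * rel t0 t1 (x i) ≤ x j ∧ x j ≤ b + s - H * rel t0 t1 (x i) := by
  rw [upTri, mem_tri hij ht.symm (by linarith), rel_symm ht]
  constructor <;> rintro ⟨⟨h1, h2⟩, h3, h4⟩ <;> refine ⟨⟨?_, ?_⟩, ?_, ?_⟩ <;> linarith

lemma disjoint_interior_of_graph {i j : Fin 2} (hij : i ≠ j) (t0 t1 c d : ℝ) {S S' : Set Plane}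
    (hS : ∀ x ∈ S, x j ≤ c + d * rel t0 t1 (x i))
    (hS' : ∀ x ∈ S', c + d * rel t0 t1 (x i) ≤ x j) : Disjoint (interior S) (interior S') := by
  refine disjoint_interior (f := fun x => x j - (c + d * rel t0 t1 (x i))) (v := e2 j)
    (fun x t => ?_) (fun x hx => sub_nonpos.2 (hS x hx)) fun x hx => sub_nonneg.2 (hS' x hx)
  simp only [PiLp.add_apply, PiLp.smul_apply, e2_self, e2_of_ne hij.symm, smul_eq_mul]
  ring_nf

lemma disjoint_interior_loTri_upTri {i j : Fin 2} (hij : i ≠ j) {t0 t1 b s H : ℝ} (ht : t0 ≠ t1)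
    (hs : 0 < s) (hH : 2 * H < s) :
    Disjoint (interior (loTri i j t0 t1 b s H)) (interior (upTri i j t0 t1 b s H)) := by
  refine disjoint_interior_of_graph hij t0 t1 b (s - H) (fun x hx => ?_) fun x hx => ?_
  · linarith [((mem_loTri hij ht hH x).1 hx).2.2]
  · linarith [((mem_upTri hij ht hs x).1 hx).2.1]

lemma triangulated_col {i j : Fin 2} (hij : i ≠ j) {t0 t1 b s H : ℝ} (ht : t0 ≠ t1)
    (hH0 : 0 < H) (hH : 2 * H < s) (P : Plane →ᵃ[ℝ] Plane) {h : Plane → Plane}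
    (hh : ∀ x ∈ col i j t0 t1 b s,
      h x = P (x + min (H * rel t0 t1 (x i)) (min (x j - b) (b + s - x j)) • e2 i)) :
    Triangulated h (col i j t0 t1 b s) := by
  have hs : 0 < s := by linarith
  set T1 := tri i j t0 t1 b b (b + H)
  set T4 := tri i j t0 t1 (b + s) (b + s - H) (b + s)
  have m1 : ∀ x, x ∈ T1 ↔ (0 ≤ rel t0 t1 (x i) ∧ rel t0 t1 (x i) ≤ 1) ∧
      b ≤ x j ∧ x j ≤ b + H * rel t0 t1 (x i) := fun x => by
    rw [mem_tri hij ht (by linarith)]; simp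
  have m4 : ∀ x, x ∈ T4 ↔ (0 ≤ rel t0 t1 (x i) ∧ rel t0 t1 (x i) ≤ 1) ∧
      b + s - H * rel t0 t1 (x i) ≤ x j ∧ x j ≤ b + s := fun x => by
    rw [mem_tri hij ht (by linarith), show b + s - H - (b + s) = -H by ring]
    simp [sub_eq_add_neg]
  have m2 := mem_loTri hij ht hH (b := b)
  have m3 := mem_upTri hij ht hs (b := b) (H := H)
  have hu : col i j t0 t1 b s =
      ((T1 ∪ loTri i j t0 t1 b s H) ∪ upTri i j t0 t1 b s H) ∪ T4 := by
    ext x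
    simp only [mem_union, m1, m2, m3, m4, col, mem_ofPred_eq]
    constructor
    · rintro ⟨h1, h2, h3⟩
      rcases le_total (x j) (b + H * rel t0 t1 (x i)) with g1 | g1
      · exact Or.inl (Or.inl (Or.inl ⟨h1, h2, g1⟩))
      rcases le_total (x j) (b + (s - H) * rel t0 t1 (x i)) with g2 | g2
      · exact Or.inl (Or.inl (Or.inr ⟨h1, g1, g2⟩))
      rcases le_total (x j) (b + s - H * rel t0 t1 (x i)) with g3 | g3
      · exact Or.inl (Or.inr ⟨h1, g2, g3⟩)
      · exact Or.inr ⟨h1, g3, h3⟩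
    · rintro (((⟨h1, h2, h3⟩ | ⟨h1, h2, h3⟩) | ⟨h1, h2, h3⟩) | ⟨h1, h2, h3⟩) <;>
        refine ⟨h1, ?_, ?_⟩ <;> nlinarith [h1.1, h1.2]
  have hsub : ∀ x, x ∈ col i j t0 t1 b s ↔ _ := fun x => Set.ext_iff.1 hu x
  have key : ∀ T : Set Plane, IsClosedTriangle T → T ⊆ col i j t0 t1 b s → ∀ α β γ : ℝ,
      (∀ x ∈ T, min (H * rel t0 t1 (x i)) (min (x j - b) (b + s - x j)) =
        α + β * x i + γ * x j) → Triangulated h T := by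
    intro T hT hTc α β γ hα
    obtain ⟨A, hA⟩ := exists_affineMap P i j α β γ
    exact Triangulated.of_triangle hT A fun x hx => by rw [hh x (hTc hx), hA, hα x hx]
  have hrel : ∀ x : Plane, H * rel t0 t1 (x i) =
      -(H * t0 / (t1 - t0)) + (H / (t1 - t0)) * x i + 0 * x j := fun x => by
    unfold rel; ring
  have k1 : Triangulated h T1 := by
    refine key T1 (isClosedTriangle_tri ..) (by rw [hu]; intro x; simp only [mem_union]; tauto)
      (-b) 0 1 fun x hx => ?_
    obtain ⟨⟨h1, h1'⟩, h2, h3⟩ := (m1 x).1 hx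
    rw [min_eq_left (by nlinarith : x j - b ≤ b + s - x j), min_eq_right (by linarith)]
    ring
  have k4 : Triangulated h T4 := by
    refine key T4 (isClosedTriangle_tri ..) (by rw [hu]; intro x; simp only [mem_union]; tauto)
      (b + s) 0 (-1) fun x hx => ?_
    obtain ⟨⟨h1, h1'⟩, h2, h3⟩ := (m4 x).1 hx
    rw [min_eq_right (by nlinarith : b + s - x j ≤ x j - b), min_eq_right (by linarith)]
    ring
  have k2 : Triangulated h (loTri i j t0 t1 b s H) := by
    refine key _ (isClosedTriangle_tri ..) (by rw [hu]; intro x; simp only [mem_union]; tauto)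
      _ _ _ fun x hx => (min_eq_left ?_).trans (hrel x)
    obtain ⟨⟨h1, h1'⟩, h2, h3⟩ := (m2 x).1 hx
    exact le_min (by nlinarith) (by nlinarith)
  have k3 : Triangulated h (upTri i j t0 t1 b s H) := by
    refine key _ (isClosedTriangle_tri ..) (by rw [hu]; intro x; simp only [mem_union]; tauto)
      _ _ _ fun x hx => (min_eq_left ?_).trans (hrel x)
    obtain ⟨⟨h1, h1'⟩, h2, h3⟩ := (m3 x).1 hx
    exact le_min (by nlinarith) (by nlinarith)
  rw [hu]
  refine ((k1.union k2 ?_).union k3 ?_).union k4 ?_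
  · refine disjoint_interior_of_graph hij t0 t1 b H (fun x hx => ?_) fun x hx => ?_
    · linarith [((m1 x).1 hx).2.2]
    · linarith [((m2 x).1 hx).2.1]
  · refine disjoint_interior_of_graph hij t0 t1 b (s - H) (fun x hx => ?_) fun x hx => ?_
    · rcases hx with hx | hx
      · obtain ⟨⟨h1, h1'⟩, h2, h3⟩ := (m1 x).1 hx
        nlinarith
      · linarith [((m2 x).1 hx).2.2]
    · linarith [((m3 x).1 hx).2.1]
  · refine disjoint_interior_of_graph hij t0 t1 (b + s) (-H) (fun x hx => ?_)
      fun x hx => ?_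
    · rcases hx with (hx | hx) | hx
      · obtain ⟨⟨h1, h1'⟩, h2, h3⟩ := (m1 x).1 hx
        nlinarith
      · obtain ⟨⟨h1, h1'⟩, h2, h3⟩ := (m2 x).1 hx
        nlinarith
      · linarith [((m3 x).1 hx).2.2]
    · linarith [((m4 x).1 hx).2.1]

/-! ### The sawtooth profile -/

/-- A tooth on `[0, δ]` with slopes `A` and `-C`. -/
def tent (A C δ τ : ℝ) : ℝ := max 0 (min (A * τ) (C * (δ - τ)))

/-- `N` consecutive teeth on `[0, N δ]`. -/
def saw (A C δ : ℝ) : ℕ → ℝ → ℝ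
  | 0, _ => 0
  | N + 1, t => max (saw A C δ N t) (tent A C δ (t - N * δ))

/-- The distance to the complement of `[b, b + s]`. -/
def bump (b s y : ℝ) : ℝ := max 0 (min (y - b) (b + s - y))

section Saw

variable {A C δ m : ℝ}

lemma tent_nonneg (A C δ τ : ℝ) : 0 ≤ tent A C δ τ := le_max_left _ _

lemma tent_le (hA : 0 < A) (hC : 0 < C) (hm : 0 < m) (hAC : A * m = C * (δ - m)) (τ : ℝ) :
    tent A C δ τ ≤ A * m := by
  refine max_le (by positivity) ?_
  rcases le_total τ m with h | h
  · exact (min_le_left _ _).trans (by gcongr)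
  · exact (min_le_right _ _).trans (by rw [hAC]; gcongr)

lemma tent_eq_zero (hA : 0 < A) (hC : 0 < C) {τ : ℝ} (h : τ ≤ 0 ∨ δ ≤ τ) : tent A C δ τ = 0 := by
  refine max_eq_left ?_
  rcases h with h | h
  · exact (min_le_left _ _).trans (mul_nonpos_of_nonneg_of_nonpos hA.le h)
  · exact (min_le_right _ _).trans (mul_nonpos_of_nonneg_of_nonpos hC.le (by linarith))

lemma tent_left (hA : 0 < A) (hC : 0 < C) (hAC : A * m = C * (δ - m)) {τ : ℝ} (h0 : 0 ≤ τ)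
    (h1 : τ ≤ m) : tent A C δ τ = A * τ := by
  rw [tent, min_eq_left, max_eq_right (by positivity)]
  nlinarith

lemma tent_right (hA : 0 < A) (hC : 0 < C) (hAC : A * m = C * (δ - m)) {τ : ℝ} (h0 : m ≤ τ)
    (h1 : τ ≤ δ) : tent A C δ τ = C * (δ - τ) := by
  rw [tent, min_eq_right, max_eq_right (mul_nonneg hC.le (by linarith))]
  nlinarith

lemma tent_slope (hA : 0 < A) (hC : 0 < C) {t t' : ℝ} (h : t ≤ t') :
    tent A C δ t - C * (t' - t) ≤ tent A C δ t' := by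
  have h0 : 0 ≤ C * (t' - t) := mul_nonneg hC.le (by linarith)
  have h1 : A * t ≤ A * t' := by gcongr
  rw [sub_le_iff_le_add, tent]
  refine max_le (add_nonneg (tent_nonneg ..) h0) ?_
  rw [← sub_le_iff_le_add]
  refine le_trans (le_min ?_ ?_) (le_max_right _ _)
  · linarith [min_le_left (A * t) (C * (δ - t))]
  · linarith [min_le_right (A * t) (C * (δ - t))]

lemma exists_lipschitz_affine (α β : ℝ) : ∃ K, LipschitzWith K fun t : ℝ => α * t + β :=
  ⟨‖α‖₊, LipschitzWith.of_dist_le_mul fun x y => by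
    simp [Real.dist_eq, ← mul_sub, abs_mul]⟩

lemma exists_lipschitz_max {α : Type*} [PseudoEMetricSpace α] {f g : α → ℝ}
    (hf : ∃ K, LipschitzWith K f) (hg : ∃ K, LipschitzWith K g) :
    ∃ K, LipschitzWith K fun t => max (f t) (g t) :=
  let ⟨_, hf⟩ := hf
  let ⟨_, hg⟩ := hg
  ⟨_, hf.max hg⟩

lemma exists_lipschitz_min {α : Type*} [PseudoEMetricSpace α] {f g : α → ℝ}
    (hf : ∃ K, LipschitzWith K f) (hg : ∃ K, LipschitzWith K g) :
    ∃ K, LipschitzWith K fun t => min (f t) (g t) :=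
  let ⟨_, hf⟩ := hf
  let ⟨_, hg⟩ := hg
  ⟨_, hf.min hg⟩

lemma exists_lipschitz_saw (A C δ : ℝ) (N : ℕ) : ∃ K, LipschitzWith K (saw A C δ N) := by
  induction N with
  | zero => exact ⟨0, LipschitzWith.const _⟩
  | succ N ih =>
    refine exists_lipschitz_max ih (exists_lipschitz_max ⟨0, LipschitzWith.const _⟩
      (exists_lipschitz_min ?_ ?_))
    · obtain ⟨K, h⟩ := exists_lipschitz_affine A (-(A * (N * δ)))
      exact ⟨K, by convert h using 2; ring⟩
    · obtain ⟨K, h⟩ := exists_lipschitz_affine (-C) (C * (δ + N * δ))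
      exact ⟨K, by convert h using 2; ring⟩

lemma saw_nonneg (A C δ : ℝ) (N : ℕ) (t : ℝ) : 0 ≤ saw A C δ N t := by
  cases N with
  | zero => exact le_rfl
  | succ N => exact (tent_nonneg ..).trans (le_max_right _ _)

lemma saw_le (hA : 0 < A) (hC : 0 < C) (hm : 0 < m) (hAC : A * m = C * (δ - m)) (N : ℕ) (t : ℝ) :
    saw A C δ N t ≤ A * m := by
  induction N with
  | zero => exact (mul_pos hA hm).le
  | succ N ih => exact max_le ih (tent_le hA hC hm hAC _)

lemma saw_slope (hA : 0 < A) (hC : 0 < C) (N : ℕ) {t t' : ℝ} (h : t ≤ t') :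
    saw A C δ N t - C * (t' - t) ≤ saw A C δ N t' := by
  induction N with
  | zero => simp only [saw]; linarith [mul_nonneg hC.le (sub_nonneg.2 h)]
  | succ N ih =>
    rw [sub_le_iff_le_add]
    refine max_le ?_ ?_
    · rw [← sub_le_iff_le_add]; exact ih.trans (le_max_left _ _)
    · rw [← sub_le_iff_le_add]
      refine le_trans ?_ (le_max_right _ _)
      have := tent_slope (δ := δ) hA hC (sub_le_sub_right h (N * δ))
      rwa [sub_sub_sub_cancel_right] at this

lemma saw_eq_zero (hA : 0 < A) (hC : 0 < C) (hδ : 0 < δ) (N : ℕ) {t : ℝ}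
    (h : t ≤ 0 ∨ N * δ ≤ t) : saw A C δ N t = 0 := by
  induction N with
  | zero => rfl
  | succ N ih =>
    push_cast at h
    have hN : 0 ≤ N * δ := by positivity
    rw [saw, ih (h.imp id fun h => by linarith), tent_eq_zero hA hC, max_self]
    exact h.imp (fun h => by linarith) fun h => by linarith

lemma saw_eq_tent (hA : 0 < A) (hC : 0 < C) (hδ : 0 < δ) {N k : ℕ} (hk : k < N) {t : ℝ}
    (h0 : k * δ ≤ t) (h1 : t ≤ (k + 1) * δ) : saw A C δ N t = tent A C δ (t - k * δ) := by
  induction N with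
  | zero => omega
  | succ N ih =>
    rcases Nat.lt_succ_iff_lt_or_eq.1 hk with hk | rfl
    · have : ((k + 1 : ℕ) : ℝ) * δ ≤ N * δ := by gcongr; omega
      push_cast at this
      rw [saw, ih hk, tent_eq_zero (δ := δ) hA hC (τ := t - N * δ) (Or.inl (by linarith)),
        max_eq_left (tent_nonneg ..)]
    · rw [saw, saw_eq_zero hA hC hδ _ (Or.inr h0), max_eq_right (tent_nonneg ..)]

end Saw

lemma bump_nonneg (b s y : ℝ) : 0 ≤ bump b s y := le_max_left _ _

lemma bump_of_mem {b s y : ℝ} (h0 : b ≤ y) (h1 : y ≤ b + s) :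
    bump b s y = min (y - b) (b + s - y) :=
  max_eq_right (le_min (by linarith) (by linarith))

lemma bump_eq_zero {b s y : ℝ} (h : y ≤ b ∨ b + s ≤ y) : bump b s y = 0 := by
  refine max_eq_left ?_
  rcases h with h | h
  · exact (min_le_left _ _).trans (by linarith)
  · exact (min_le_right _ _).trans (by linarith)

lemma lipschitz_bump (b s : ℝ) : LipschitzWith 1 (bump b s) := by
  have h1 : LipschitzWith 1 fun y : ℝ => y - b := LipschitzWith.of_dist_le_mul fun x y => by simp
  have h2 : LipschitzWith 1 fun y : ℝ => b + s - y :=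
    LipschitzWith.of_dist_le_mul fun x y => by rw [dist_sub_left]; simp
  have h := (LipschitzWith.const (0 : ℝ)).max (h1.min h2)
  rw [max_self, max_eq_right (zero_le_one : (0 : NNReal) ≤ 1)] at h
  exact h

/-- The displacement of the building block: the sawtooth profile in the `i`-th coordinate,
truncated by the distance to the two edges orthogonal to the `j`-th axis. -/
def disp (i j : Fin 2) (a b s A C δ : ℝ) (N : ℕ) (x : Plane) : ℝ :=
  min (saw A C δ N (x i - a)) (bump b s (x j))

/-- The open rectangle `(α, β) × (γ, κ)` in the coordinates `i`, `j`. -/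
def rect (i j : Fin 2) (α β γ κ : ℝ) : Set Plane := {x | (α < x i ∧ x i < β) ∧ γ < x j ∧ x j < κ}

section Disp

variable {i j : Fin 2} {a b s A C δ m : ℝ} {N : ℕ}

lemma disp_nonneg (x : Plane) : 0 ≤ disp i j a b s A C δ N x :=
  le_min (saw_nonneg ..) (bump_nonneg ..)

lemma disp_le (hA : 0 < A) (hC : 0 < C) (hm : 0 < m) (hAC : A * m = C * (δ - m)) (x : Plane) :
    disp i j a b s A C δ N x ≤ A * m := (min_le_left _ _).trans (saw_le hA hC hm hAC _ _)

lemma disp_eq_zero (hA : 0 < A) (hC : 0 < C) (hδ : 0 < δ) (hN : N * δ = s) {x : Plane}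
    (hx : x ∉ rect i j a (a + s) b (b + s)) : disp i j a b s A C δ N x = 0 := by
  have : (x i - a ≤ 0 ∨ N * δ ≤ x i - a) ∨ (x j ≤ b ∨ b + s ≤ x j) := by
    by_contra! h
    exact hx ⟨⟨by linarith, by linarith⟩, h.2⟩
  rcases this with h | h
  · rw [disp, saw_eq_zero hA hC hδ N h, min_eq_left (bump_nonneg ..)]
  · rw [disp, bump_eq_zero h, min_eq_right (saw_nonneg ..)]

lemma abs_coord_le (k : Fin 2) (x : Plane) : |x k| ≤ ‖x‖ := by
  simpa using PiLp.norm_apply_le x k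

lemma lipschitz_coord (k : Fin 2) : LipschitzWith 1 fun x : Plane => x k :=
  LipschitzWith.of_dist_le_mul fun x y => by
    simpa [Real.dist_eq, dist_eq_norm] using abs_coord_le k (x - y)

lemma exists_lipschitz_disp (i j : Fin 2) (a b s A C δ : ℝ) (N : ℕ) :
    ∃ K, LipschitzWith K (disp i j a b s A C δ N) := by
  obtain ⟨K, hK⟩ := exists_lipschitz_saw A C δ N
  obtain ⟨K', hK'⟩ := exists_lipschitz_affine 1 (-a)
  refine exists_lipschitz_min ⟨K * (K' * 1), hK.comp ?_⟩
    ⟨1 * 1, (lipschitz_bump b s).comp (lipschitz_coord j)⟩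
  convert hK'.comp (lipschitz_coord i) using 2
  simp [sub_eq_add_neg]

/-- Along the `i`-th direction the displacement has slope at least `-C`. -/
lemma disp_slope (hA : 0 < A) (hC : 0 < C) {x y : Plane} (hj : x j = y j) (h : x i ≤ y i) :
    disp i j a b s A C δ N x - C * (y i - x i) ≤ disp i j a b s A C δ N y := by
  have h0 : 0 ≤ C * (y i - x i) := mul_nonneg hC.le (by linarith)
  have h1 := saw_slope (δ := δ) hA hC N (sub_le_sub_right h a)
  rw [sub_sub_sub_cancel_right] at h1
  refine le_min ?_ ?_
  · refine le_trans (sub_le_sub_right (min_le_left _ _) _) h1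
  · rw [← hj]
    exact (sub_le_self _ h0).trans (min_le_right _ _)

/-- Along the `j`-th direction the displacement is `1`-Lipschitz. -/
lemma abs_disp_sub_le {x y : Plane} (hi : x i = y i) :
    |disp i j a b s A C δ N x - disp i j a b s A C δ N y| ≤ |x j - y j| := by
  have h := abs_min_sub_min_le_max (saw A C δ N (x i - a)) (bump b s (x j))
    (saw A C δ N (y i - a)) (bump b s (y j))
  rw [hi, sub_self, abs_zero, max_eq_right (abs_nonneg _)] at h
  rw [disp, disp, hi]
  exact h.trans (by simpa [Real.dist_eq] using (lipschitz_bump b s).dist_le_mul (x j) (y j))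

end Disp

/-! ### The shear homeomorphism -/

/-- The homeomorphism of the plane displacing each point in the `i`-th direction. -/
def shear (i j : Fin 2) (a b s A C δ : ℝ) (N : ℕ) (x : Plane) : Plane :=
  x + disp i j a b s A C δ N x • e2 i

section Shear

variable {i j : Fin 2} {a b s A C δ m : ℝ} {N : ℕ}

lemma shear_fst (x : Plane) :
    shear i j a b s A C δ N x i = x i + disp i j a b s A C δ N x := by
  simp [shear, e2_self]

lemma shear_snd (hij : i ≠ j) (x : Plane) : shear i j a b s A C δ N x j = x j := by
  simp [shear, e2_of_ne hij]

lemma exists_lipschitz_shear (i j : Fin 2) (a b s A C δ : ℝ) (N : ℕ) :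
    ∃ K, LipschitzWith K (shear i j a b s A C δ N) := by
  obtain ⟨K, hK⟩ := exists_lipschitz_disp i j a b s A C δ N
  refine ⟨1 + K, LipschitzWith.id.add (LipschitzWith.of_dist_le_mul fun x y => ?_)⟩
  rw [dist_eq_norm, ← sub_smul, norm_smul]
  simpa [e2, Real.dist_eq] using hK.dist_le_mul x y

lemma shear_expand (hij : i ≠ j) (hA : 0 < A) (hC : 0 < C) {x y : Plane} (h : y i ≤ x i) :
    (1 - C) * (x i - y i) ≤
      (shear i j a b s A C δ N x - shear i j a b s A C δ N y) i + |x j - y j| := by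
  set z := pt i j (y i) (x j)
  have hz1 : z i = y i := pt_fst hij _ _
  have hz2 : z j = x j := pt_snd hij _ _
  have h1 := disp_slope (a := a) (b := b) (s := s) (δ := δ) (N := N) hA hC hz2 (by rwa [hz1])
  have h2 := (abs_le.1 (abs_disp_sub_le (j := j) (a := a) (b := b) (s := s) (A := A) (C := C)
    (δ := δ) (N := N) hz1)).1
  rw [hz1] at h1
  rw [hz2] at h2
  rw [PiLp.sub_apply, shear_fst, shear_fst]
  linarith

lemma antilipschitz_shear (hij : i ≠ j) (hA : 0 < A) (hC : 0 < C) (hC1 : C < 1) :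
    ∃ K, AntilipschitzWith K (shear i j a b s A C δ N) := by
  have hc : 0 < 1 - C := by linarith
  refine ⟨Real.toNNReal (2 / (1 - C) + 1), AntilipschitzWith.of_le_mul_dist fun x y => ?_⟩
  wlog h : y i ≤ x i generalizing x y
  · rw [dist_comm x, dist_comm (shear i j a b s A C δ N x)]
    exact this y x (le_of_not_ge h)
  have h1 := shear_expand (a := a) (b := b) (s := s) (δ := δ) (N := N) hij hA hC h
  set D := dist (shear i j a b s A C δ N x) (shear i j a b s A C δ N y) with hD
  have hi := abs_coord_le i (shear i j a b s A C δ N x - shear i j a b s A C δ N y)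
  have hj := abs_coord_le j (shear i j a b s A C δ N x - shear i j a b s A C δ N y)
  rw [← dist_eq_norm, ← hD] at hi hj
  rw [PiLp.sub_apply, shear_snd hij, shear_snd hij] at hj
  have h2 : x i - y i ≤ 2 / (1 - C) * D := by
    rw [div_mul_eq_mul_div, le_div_iff₀ hc]
    linarith [le_abs_self ((shear i j a b s A C δ N x - shear i j a b s A C δ N y) i)]
  have h3 : dist x y ≤ |x i - y i| + |x j - y j| := by
    have e : x - y = (x i - y i) • e2 i + (x j - y j) • e2 j := by
      refine plane_ext hij ?_ ?_ <;> simp [e2_self, e2_of_ne hij, e2_of_ne hij.symm]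
    rw [dist_eq_norm, e]
    refine (norm_add_le _ _).trans ?_
    simp [norm_smul, e2]
  rw [Real.coe_toNNReal _ (by positivity)]
  rw [abs_of_nonneg (sub_nonneg.2 h)] at h3
  linarith

lemma surjective_shear (hij : i ≠ j) (hA : 0 < A) (hC : 0 < C) (hm : 0 < m)
    (hAC : A * m = C * (δ - m)) : Function.Surjective (shear i j a b s A C δ N) := by
  intro y
  obtain ⟨K, hK⟩ := exists_lipschitz_disp i j a b s A C δ N
  have hcont : Continuous fun t => t + disp i j a b s A C δ N (pt i j t (y j)) := by
    have : Continuous fun t => pt i j t (y j) := by unfold pt; fun_prop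
    exact continuous_id.add (hK.continuous.comp this)
  have htop : Filter.Tendsto (fun t => t + disp i j a b s A C δ N (pt i j t (y j)))
      Filter.atTop Filter.atTop :=
    Filter.tendsto_atTop_mono (fun t => le_add_of_nonneg_right (disp_nonneg _)) Filter.tendsto_id
  have hbot : Filter.Tendsto (fun t => t + disp i j a b s A C δ N (pt i j t (y j)))
      Filter.atBot Filter.atBot :=
    Filter.tendsto_atBot_mono (fun t => add_le_add_right (disp_le hA hC hm hAC _) t)
      (Filter.tendsto_atBot_add_const_right _ (A * m) Filter.tendsto_id)
  obtain ⟨t, ht⟩ := hcont.surjective htop hbot (y i)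
  refine ⟨pt i j t (y j), plane_ext hij ?_ ?_⟩
  · rw [shear_fst, pt_fst hij]; exact ht
  · rw [shear_snd hij, pt_snd hij]

lemma shear_eq_self (hA : 0 < A) (hC : 0 < C) (hδ : 0 < δ) (hN : N * δ = s) {x : Plane}
    (hx : x ∉ rect i j a (a + s) b (b + s)) : shear i j a b s A C δ N x = x := by
  simp [shear, disp_eq_zero hA hC hδ hN hx]

/-- An affine homeomorphism composed with the shear is a homeomorphism of the open square. -/
lemma exists_isHomeoOn_shear (hij : i ≠ j) (hA : 0 < A) (hC : 0 < C) (hC1 : C < 1) (hm : 0 < m)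
    (hδ : 0 < δ) (hAC : A * m = C * (δ - m)) (hN : N * δ = s) (P : Plane →ᵃ[ℝ] Plane)
    (hP : Function.Bijective P.linear) :
    ∃ g, IsHomeoOn (fun x => P (shear i j a b s A C δ N x)) g
      (rect i j a (a + s) b (b + s)) (P '' rect i j a (a + s) b (b + s)) := by
  set Q := rect i j a (a + s) b (b + s)
  set ψ := shear i j a b s A C δ N with hψ
  obtain ⟨K, hK⟩ := exists_lipschitz_shear i j a b s A C δ N
  obtain ⟨K', hK'⟩ := antilipschitz_shear (a := a) (b := b) (s := s) (δ := δ) (N := N)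
    hij hA hC hC1
  have hsurj := surjective_shear (a := a) (b := b) (s := s) (N := N) hij hA hC hm hAC
  rw [← hψ] at hK hK' hsurj
  have hinj := hK'.injective
  have hPb : Function.Bijective P :=
    ⟨P.linear_injective_iff.1 hP.1, P.linear_surjective_iff.1 hP.2⟩
  let e := AffineEquiv.ofBijective hPb
  have he : ∀ x, e x = P x := fun x => rfl
  obtain ⟨χ, hχ⟩ := hsurj.hasRightInverse
  have hχl : Function.LeftInverse χ ψ := fun x => hinj (hχ _)
  have hout : ∀ x, x ∉ Q → ψ x = x := fun x hx => shear_eq_self hA hC hδ hN hx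
  have hmaps : ∀ x ∈ Q, ψ x ∈ Q := fun x hx => by
    by_contra h
    exact h (by rw [hinj (hout _ h)]; exact hx)
  have hmaps' : ∀ x ∈ Q, χ x ∈ Q := fun x hx => by
    by_contra h
    have := hout _ h
    rw [hχ] at this
    exact h (this ▸ hx)
  have hcP : Continuous P := AffineMap.continuous_of_finiteDimensional P
  have hce : Continuous e.symm := AffineMap.continuous_of_finiteDimensional e.symm.toAffineMap
  refine ⟨fun y => χ (e.symm y), ⟨fun x hx => ⟨_, hmaps x hx, rfl⟩,
    (hPb.1.comp hinj).injOn, ?_⟩, (hcP.comp hK.continuous).continuousOn, ⟨?_, ?_⟩,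
    ((hK'.to_rightInverse hχ).continuous.comp hce).continuousOn⟩
  · rintro _ ⟨x, hx, rfl⟩
    exact ⟨χ x, hmaps' x hx, by simp only [hχ x]⟩
  · intro x _
    simp only [← he, AffineEquiv.symm_apply_apply]
    exact hχl x
  · intro y _
    simp only [hχ (e.symm y), ← he, AffineEquiv.apply_symm_apply]

end Shear

/-! ### The triangulation of the square -/

lemma rel_mem_iff_of_lt {t0 t1 t : ℝ} (h : t0 < t1) :
    (0 ≤ rel t0 t1 t ∧ rel t0 t1 t ≤ 1) ↔ t0 ≤ t ∧ t ≤ t1 := by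
  have : 0 < t1 - t0 := sub_pos.2 h
  rw [rel, le_div_iff₀ this, zero_mul, div_le_one this, sub_nonneg, sub_le_sub_iff_right]

lemma rel_mem_iff_of_gt {t0 t1 t : ℝ} (h : t1 < t0) :
    (0 ≤ rel t0 t1 t ∧ rel t0 t1 t ≤ 1) ↔ t1 ≤ t ∧ t ≤ t0 := by
  rw [← rel_mem_iff_of_lt h, rel_symm h.ne]
  constructor <;> rintro ⟨h1, h2⟩ <;> constructor <;> linarith

/-- The closed rectangle `[α, β] × [γ, κ]` in the coordinates `i`, `j`. -/
def crect (i j : Fin 2) (α β γ κ : ℝ) : Set Plane :=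
  {x | (α ≤ x i ∧ x i ≤ β) ∧ γ ≤ x j ∧ x j ≤ κ}

lemma col_eq_crect_of_lt (i j : Fin 2) {t0 t1 : ℝ} (b s : ℝ) (h : t0 < t1) :
    col i j t0 t1 b s = crect i j t0 t1 b (b + s) := by
  ext x; simp only [col, crect, mem_ofPred_eq, rel_mem_iff_of_lt h]

lemma col_eq_crect_of_gt (i j : Fin 2) {t0 t1 : ℝ} (b s : ℝ) (h : t1 < t0) :
    col i j t0 t1 b s = crect i j t1 t0 b (b + s) := by
  ext x; simp only [col, crect, mem_ofPred_eq, rel_mem_iff_of_gt h]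

lemma crect_union_crect (i j : Fin 2) {α β β' γ κ : ℝ} (h : α ≤ β) (h' : β ≤ β') :
    crect i j α β γ κ ∪ crect i j β β' γ κ = crect i j α β' γ κ := by
  ext x
  simp only [crect, mem_union, mem_ofPred_eq]
  constructor
  · rintro (⟨⟨h1, h2⟩, h3⟩ | ⟨⟨h1, h2⟩, h3⟩)
    · exact ⟨⟨h1, h2.trans h'⟩, h3⟩
    · exact ⟨⟨h.trans h1, h2⟩, h3⟩
  · rintro ⟨⟨h1, h2⟩, h3⟩
    rcases le_total (x i) β with g | g
    · exact Or.inl ⟨⟨h1, g⟩, h3⟩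
    · exact Or.inr ⟨⟨g, h2⟩, h3⟩

lemma coord_sub_add_smul (i : Fin 2) (c : ℝ) (x : Plane) (t : ℝ) :
    (x + t • e2 i) i - c = x i - c + t := by
  simp only [PiLp.add_apply, PiLp.smul_apply, e2_self, smul_eq_mul]; ring

lemma interior_crect_subset {i j : Fin 2} (α β γ κ : ℝ) :
    interior (crect i j α β γ κ) ⊆ rect i j α β γ κ := by
  intro x hx
  refine ⟨⟨?_, ?_⟩, ?_, ?_⟩
  · exact sub_pos.1 (pos_of_mem_interior (f := fun x => x i - α) (coord_sub_add_smul i α)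
      (fun y hy => sub_nonneg.2 hy.1.1) hx)
  · exact sub_neg.1 (neg_of_mem_interior (f := fun x => x i - β) (coord_sub_add_smul i β)
      (fun y hy => sub_nonpos.2 hy.1.2) hx)
  · exact sub_pos.1 (pos_of_mem_interior (f := fun x => x j - γ) (coord_sub_add_smul j γ)
      (fun y hy => sub_nonneg.2 hy.2.1) hx)
  · exact sub_neg.1 (neg_of_mem_interior (f := fun x => x j - κ) (coord_sub_add_smul j κ)
      (fun y hy => sub_nonpos.2 hy.2.2) hx)

lemma disjoint_interior_crect (i j : Fin 2) (α β β' γ κ : ℝ) :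
    Disjoint (interior (crect i j α β γ κ)) (interior (crect i j β β' γ κ)) :=
  disjoint_interior (coord_sub_add_smul i β) (fun _ hx => sub_nonpos.2 hx.1.2)
    fun _ hx => sub_nonneg.2 hx.1.1

lemma isOpen_rect (i j : Fin 2) (α β γ κ : ℝ) : IsOpen (rect i j α β γ κ) := by
  have h : ∀ k : Fin 2, Continuous fun x : Plane => x k := fun k => (lipschitz_coord k).continuous
  exact ((isOpen_lt continuous_const (h i)).inter (isOpen_lt (h i) continuous_const)).inter
    ((isOpen_lt continuous_const (h j)).inter (isOpen_lt (h j) continuous_const))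

lemma closure_rect {i j : Fin 2} (hij : i ≠ j) {α β γ κ : ℝ} (h : α < β) (h' : γ < κ) :
    closure (rect i j α β γ κ) = crect i j α β γ κ := by
  have hc : ∀ k : Fin 2, Continuous fun x : Plane => x k := fun k => (lipschitz_coord k).continuous
  refine Subset.antisymm (closure_minimal (fun x hx => ⟨⟨hx.1.1.le, hx.1.2.le⟩, hx.2.1.le,
    hx.2.2.le⟩) ?_) fun x hx => ?_
  · exact ((isClosed_le continuous_const (hc i)).inter
      (isClosed_le (hc i) continuous_const)).inter
      ((isClosed_le continuous_const (hc j)).inter (isClosed_le (hc j) continuous_const))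
  · set c := pt i j ((α + β) / 2) ((γ + κ) / 2) with hcdef
    have hlim : Filter.Tendsto (fun t : ℝ => x + t • (c - x)) (nhdsWithin 0 (Ioi 0)) (nhds x) := by
      have : Continuous fun t : ℝ => x + t • (c - x) := by fun_prop
      simpa using (this.tendsto 0).mono_left nhdsWithin_le_nhds
    refine mem_closure_of_tendsto hlim ?_
    filter_upwards [Ioo_mem_nhdsGT (zero_lt_one' ℝ)] with t ht
    obtain ⟨⟨h1, h2⟩, h3, h4⟩ := hx
    obtain ⟨ht0, ht1⟩ := ht
    have ht1' : 0 < 1 - t := sub_pos.2 ht1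
    refine ⟨⟨?_, ?_⟩, ?_, ?_⟩ <;>
      simp only [PiLp.add_apply, PiLp.smul_apply, PiLp.sub_apply, hcdef, pt_fst hij, pt_snd hij,
        smul_eq_mul] <;>
      nlinarith

section Tooth

variable {i j : Fin 2} {a b s A C δ m : ℝ} {N k : ℕ}

lemma disp_left (hA : 0 < A) (hC : 0 < C) (hδ : 0 < δ) (hm : 0 < m) (hmδ : m < δ)
    (hAC : A * m = C * (δ - m)) (hk : k < N) {x : Plane}
    (hx : x ∈ col i j (a + k * δ) (a + k * δ + m) b s) :
    disp i j a b s A C δ N x = min (A * m * rel (a + k * δ) (a + k * δ + m) (x i))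
      (min (x j - b) (b + s - x j)) := by
  obtain ⟨h1, h2, h3⟩ := hx
  rw [rel_mem_iff_of_lt (by linarith)] at h1
  rw [disp, bump_of_mem h2 h3, saw_eq_tent hA hC hδ hk (by linarith) (by linarith),
    tent_left hA hC hAC (by linarith) (by linarith), rel]
  congr 1
  rw [add_sub_cancel_left]
  field_simp
  ring

lemma disp_right (hA : 0 < A) (hC : 0 < C) (hδ : 0 < δ) (hm : 0 < m) (hmδ : m < δ)
    (hAC : A * m = C * (δ - m)) (hk : k < N) {x : Plane}
    (hx : x ∈ col i j (a + (k + 1) * δ) (a + k * δ + m) b s) :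
    disp i j a b s A C δ N x = min (A * m * rel (a + (k + 1) * δ) (a + k * δ + m) (x i))
      (min (x j - b) (b + s - x j)) := by
  obtain ⟨h1, h2, h3⟩ := hx
  rw [rel_mem_iff_of_gt (by linarith)] at h1
  have hne : m - δ ≠ 0 := (sub_neg.2 hmδ).ne
  rw [disp, bump_of_mem h2 h3, saw_eq_tent hA hC hδ hk (by linarith) (by linarith),
    tent_right hA hC hAC (by linarith) (by linarith), rel, hAC]
  congr 1
  rw [show a + k * δ + m - (a + (k + 1) * δ) = m - δ by ring]
  field_simp
  ring

lemma triangulated_strip (hij : i ≠ j) (hA : 0 < A) (hC : 0 < C) (hδ : 0 < δ) (hm : 0 < m)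
    (hmδ : m < δ) (hAC : A * m = C * (δ - m)) (hs : 2 * (A * m) < s) (P : Plane →ᵃ[ℝ] Plane)
    (hk : k < N) :
    Triangulated (fun x => P (shear i j a b s A C δ N x))
      (crect i j a (a + (k + 1) * δ) b (b + s)) := by
  have hH : 0 < A * m := by positivity
  have tooth : ∀ k < N, Triangulated (fun x => P (shear i j a b s A C δ N x))
      (crect i j (a + k * δ) (a + (k + 1) * δ) b (b + s)) := by
    intro k hk
    have h1 : a + k * δ < a + k * δ + m := by linarith
    have h2 : a + k * δ + m < a + (k + 1) * δ := by linarith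
    rw [← crect_union_crect i j h1.le h2.le]
    refine Triangulated.union ?_ ?_ (disjoint_interior_crect ..)
    · rw [← col_eq_crect_of_lt i j b s h1]
      refine triangulated_col hij h1.ne hH hs P fun x hx => ?_
      rw [shear, disp_left hA hC hδ hm hmδ hAC hk hx]
    · rw [← col_eq_crect_of_gt i j b s h2]
      refine triangulated_col hij h2.ne' hH hs P fun x hx => ?_
      rw [shear, disp_right hA hC hδ hm hmδ hAC hk hx]
  induction k with
  | zero => simpa using tooth 0 hk
  | succ k ih =>
    have h0 : 0 ≤ (k + 1 : ℝ) * δ := by positivity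
    have h := tooth (k + 1) hk
    push_cast at h ⊢
    rw [← crect_union_crect i j (β := a + (k + 1) * δ) (by linarith) (by linarith)]
    exact (ih (by omega)).union h (disjoint_interior_crect ..)

lemma piecewiseAffineOn_shear (hij : i ≠ j) (hA : 0 < A) (hC : 0 < C) (hδ : 0 < δ) (hm : 0 < m)
    (hmδ : m < δ) (hAC : A * m = C * (δ - m)) (hs : 2 * (A * m) < s) (hN : N * δ = s)
    (P : Plane →ᵃ[ℝ] Plane) :
    PiecewiseAffineOn (fun x => P (shear i j a b s A C δ N x))
      (rect i j a (a + s) b (b + s)) := by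
  have hs0 : 0 < s := by linarith [mul_pos hA hm]
  obtain ⟨k, rfl⟩ : ∃ k, N = k + 1 :=
    Nat.exists_eq_succ_of_ne_zero (by rintro rfl; simp at hN; linarith)
  have h := triangulated_strip (a := a) (b := b) hij hA hC hδ hm hmδ hAC hs P k.lt_succ_self
  push_cast at hN
  rw [hN, ← closure_rect hij (by linarith) (by linarith)] at h
  obtain ⟨n, T, h1, h2, h3, h4⟩ := h
  exact ⟨n, T, h1, h2, h3, fun l => (h4 l).imp fun _ hB => hB.mono inter_subset_right⟩

end Tooth

/-! ### The triangles on which the displacement is steep -/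

lemma volume_rect {i j : Fin 2} (hij : i ≠ j) (α β γ κ : ℝ) :
    volume (rect i j α β γ κ) = ENNReal.ofReal (β - α) * ENNReal.ofReal (κ - γ) := by
  have h : rect i j α β γ κ = (WithLp.ofLp : Plane → Fin 2 → ℝ) ⁻¹'
      univ.pi fun k => if k = i then Ioo α β else Ioo γ κ := by
    ext x
    simp only [rect, mem_preimage, mem_univ_pi, mem_ofPred_eq]
    constructor
    · rintro ⟨h1, h2⟩ k
      rcases eq_or_eq_of_ne hij k with rfl | rfl
      · simpa using h1
      · simpa [hij.symm] using h2
    · intro h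
      exact ⟨by simpa using h i, by simpa [hij.symm] using h j⟩
  rw [h, (PiLp.volume_preserving_ofLp (Fin 2)).measure_preimage, volume_pi_pi]
  · rcases eq_or_eq_of_ne hij 0 with rfl | rfl
    · obtain rfl : j = 1 := by omega
      simp
    · obtain rfl : i = 1 := by omega
      simp [mul_comm]
  · refine (MeasurableSet.univ_pi fun k => ?_).nullMeasurableSet
    split_ifs <;> exact measurableSet_Ioo

lemma volume_le_volume_interior {T : Set Plane} (hT : Convex ℝ T) :
    volume T ≤ volume (interior T) := by
  calc volume T ≤ volume (interior T ∪ frontier T) :=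
        measure_mono (subset_closure.trans (closure_eq_interior_union_frontier T).subset)
    _ ≤ volume (interior T) + volume (frontier T) := measure_union_le _ _
    _ = volume (interior T) := by rw [hT.addHaar_frontier volume, add_zero]

section Active

variable {i j : Fin 2} {a b s A C δ m : ℝ} {N k : ℕ}

lemma loTri_subset (hij : i ≠ j) {t0 t1 H : ℝ} (h : t0 < t1) (hH0 : 0 < H) (hH : 2 * H < s) :
    loTri i j t0 t1 b s H ⊆ crect i j t0 t1 b (b + s) := by
  intro x hx
  obtain ⟨h1, h2, h3⟩ := (mem_loTri hij h.ne hH x).1 hx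
  exact ⟨(rel_mem_iff_of_lt h).1 h1, by nlinarith [h1.1], by nlinarith [h1.2]⟩

lemma upTri_subset (hij : i ≠ j) {t0 t1 H : ℝ} (h : t0 < t1) (hH0 : 0 < H) (hH : 2 * H < s) :
    upTri i j t0 t1 b s H ⊆ crect i j t0 t1 b (b + s) := by
  intro x hx
  obtain ⟨h1, h2, h3⟩ := (mem_upTri hij h.ne (by linarith) x).1 hx
  exact ⟨(rel_mem_iff_of_lt h).1 h1, by nlinarith [h1.1], by nlinarith [h1.1]⟩

lemma rect_subset_loTri_union_upTri (hij : i ≠ j) {t0 t1 H : ℝ} (h : t0 < t1) (hH0 : 0 < H)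
    (hH : 2 * H < s) : rect i j t0 t1 (b + H) (b + s - H) ⊆
      loTri i j t0 t1 b s H ∪ upTri i j t0 t1 b s H := by
  rintro x ⟨⟨h1, h2⟩, h3, h4⟩
  have hr := (rel_mem_iff_of_lt h).2 ⟨h1.le, h2.le⟩
  rcases le_total (x j) (b + (s - H) * rel t0 t1 (x i)) with g | g
  · exact Or.inl ((mem_loTri hij h.ne hH x).2 ⟨hr, by nlinarith [hr.2], g⟩)
  · exact Or.inr ((mem_upTri hij h.ne (by linarith) x).2 ⟨hr, g, by nlinarith [hr.2]⟩)

lemma disp_of_mem_loTri_union_upTri (hij : i ≠ j) (hA : 0 < A) (hC : 0 < C) (hδ : 0 < δ)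
    (hm : 0 < m) (hmδ : m < δ) (hAC : A * m = C * (δ - m)) (hs : 2 * (A * m) < s) (hk : k < N)
    {x : Plane} (hx : x ∈ loTri i j (a + k * δ) (a + k * δ + m) b s (A * m) ∪
      upTri i j (a + k * δ) (a + k * δ + m) b s (A * m)) :
    disp i j a b s A C δ N x = A * (x i - (a + k * δ)) := by
  have hH : 0 < A * m := by positivity
  have h : a + k * δ < a + k * δ + m := by linarith
  have hrel : A * m * rel (a + k * δ) (a + k * δ + m) (x i) = A * (x i - (a + k * δ)) := by
    rw [rel, add_sub_cancel_left]
    field_simp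
  have hcol : x ∈ col i j (a + k * δ) (a + k * δ + m) b s := by
    rw [col_eq_crect_of_lt i j b s h]
    exact hx.elim (fun hx => loTri_subset hij h hH hs hx) fun hx => upTri_subset hij h hH hs hx
  rw [disp_left hA hC hδ hm hmδ hAC hk hcol, ← hrel]
  refine min_eq_left (le_min ?_ ?_) <;> rcases hx with hx | hx
  · linarith [((mem_loTri hij h.ne hs x).1 hx).2.1]
  · obtain ⟨h1, h2, h3⟩ := (mem_upTri hij h.ne (by linarith) x).1 hx
    nlinarith [h1.1]
  · obtain ⟨h1, h2, h3⟩ := (mem_loTri hij h.ne hs x).1 hx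
    nlinarith [h1.2]
  · linarith [((mem_upTri hij h.ne (by linarith) x).1 hx).2.2]

/-- A finite union of triangles covering most of the part of the square where the displacement
has slope `A` in the `i`-th direction. -/
lemma exists_active_set (hij : i ≠ j) (hA : 0 < A) (hC : 0 < C) (hδ : 0 < δ)
    (hm : 0 < m) (hmδ : m < δ) (hAC : A * m = C * (δ - m)) (hs : 2 * (A * m) < s) (hk : k ≤ N) :
    ∃ F, IsOpen F ∧ FinUnionTriangles F ∧ F ⊆ rect i j a (a + k * δ) b (b + s) ∧
      (∀ x ∈ F, ∃ c, ∀ᶠ y in nhds x, disp i j a b s A C δ N y = A * (y i - c)) ∧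
      volume F ≤ ENNReal.ofReal (k * (m * s)) ∧
      ENNReal.ofReal (k * (m * (s - 2 * (A * m)))) ≤ volume F := by
  have hH : 0 < A * m := by positivity
  have hs0 : 0 < s := by linarith
  induction k with
  | zero =>
    exact ⟨∅, isOpen_empty, .empty, empty_subset _, fun x hx => hx.elim, by simp, by simp⟩
  | succ k ih =>
    obtain ⟨F, h1, h2, h3, h4, h5, h6⟩ := ih (by omega)
    have h : a + k * δ < a + k * δ + m := by linarith
    set T := loTri i j (a + k * δ) (a + k * δ + m) b s (A * m) with hT
    set T' := upTri i j (a + k * δ) (a + k * δ + m) b s (A * m) with hT'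
    set R := rect i j (a + k * δ) (a + k * δ + m) b (b + s) with hR
    have hTR : interior T ⊆ R :=
      (interior_mono (loTri_subset hij h hH hs)).trans (interior_crect_subset ..)
    have hTR' : interior T' ⊆ R :=
      (interior_mono (upTri_subset hij h hH hs)).trans (interior_crect_subset ..)
    have hTT : Disjoint (interior T) (interior T') :=
      disjoint_interior_loTri_upTri hij h.ne hs0 hs
    have hGR : interior T ∪ interior T' ⊆ R := union_subset hTR hTR'
    have hFR : Disjoint F (interior T ∪ interior T') :=
      disjoint_left.2 fun x hx hx' => (hGR hx').1.1.not_gt (h3 hx).1.2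
    have hcT : Convex ℝ T := convex_convexHull ..
    have hcT' : Convex ℝ T' := convex_convexHull ..
    have hGo : IsOpen (interior T ∪ interior T') := isOpen_interior.union isOpen_interior
    have hk0 : 0 ≤ k * δ := by positivity
    have hvol : volume (F ∪ (interior T ∪ interior T')) =
        volume F + volume (interior T ∪ interior T') := measure_union hFR hGo.measurableSet
    refine ⟨F ∪ (interior T ∪ interior T'), h1.union hGo, h2.union (.union (.of_triangle
      ⟨_, _, _, rfl⟩) (.of_triangle ⟨_, _, _, rfl⟩) hTT) hFR, union_subset ?_ ?_, ?_, ?_, ?_⟩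
    · intro x hx
      obtain ⟨⟨g1, g2⟩, g3⟩ := h3 hx
      exact ⟨⟨g1, by push_cast; linarith⟩, g3⟩
    · intro x hx
      obtain ⟨⟨g1, g2⟩, g3⟩ := hGR hx
      exact ⟨⟨by linarith, by push_cast; linarith⟩, g3⟩
    · rintro x (hx | hx)
      · exact h4 x hx
      · refine ⟨a + k * δ, (hGo.eventually_mem hx).mono fun y hy => ?_⟩
        exact disp_of_mem_loTri_union_upTri hij hA hC hδ hm hmδ hAC hs hk
          (union_subset_union interior_subset interior_subset hy)
    · rw [hvol, show ((k + 1 : ℕ) : ℝ) * (m * s) = k * (m * s) + m * s by push_cast; ring,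
        ENNReal.ofReal_add (by positivity) (by positivity)]
      refine add_le_add h5 ((measure_mono hGR).trans ?_)
      rw [hR, volume_rect hij, add_sub_cancel_left, add_sub_cancel_left,
        ENNReal.ofReal_mul hm.le]
    · have hpos : 0 ≤ m * (s - 2 * (A * m)) := mul_nonneg hm.le (by linarith)
      rw [hvol, show ((k + 1 : ℕ) : ℝ) * (m * (s - 2 * (A * m))) =
        k * (m * (s - 2 * (A * m))) + m * (s - 2 * (A * m)) by push_cast; ring,
        ENNReal.ofReal_add (by positivity) hpos]
      refine add_le_add h6 ?_
      calc ENNReal.ofReal (m * (s - 2 * (A * m)))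
          = volume (rect i j (a + k * δ) (a + k * δ + m) (b + A * m) (b + s - A * m)) := by
            rw [volume_rect hij, add_sub_cancel_left, ← ENNReal.ofReal_mul hm.le]
            congr 2
            ring
        _ ≤ volume (T ∪ T') := measure_mono (rect_subset_loTri_union_upTri hij h hH hs)
        _ ≤ volume T + volume T' := measure_union_le _ _
        _ ≤ volume (interior T) + volume (interior T') :=
            add_le_add (volume_le_volume_interior hcT) (volume_le_volume_interior hcT')
        _ = volume (interior T ∪ interior T') :=
            (measure_union hTT isOpen_interior.measurableSet).symm

end Active

/-! ### Derivatives of the displacement -/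

lemma measureReal_rect {i j : Fin 2} (hij : i ≠ j) {α β γ κ : ℝ} (h : α ≤ β) (h' : γ ≤ κ) :
    volume.real (rect i j α β γ κ) = (β - α) * (κ - γ) := by
  rw [Measure.real, volume_rect hij, ENNReal.toReal_mul, ENNReal.toReal_ofReal (sub_nonneg.2 h),
    ENNReal.toReal_ofReal (sub_nonneg.2 h')]

lemma volume_rect_ne_top {i j : Fin 2} (hij : i ≠ j) (α β γ κ : ℝ) :
    volume (rect i j α β γ κ) ≠ ∞ := by
  rw [volume_rect hij]
  exact ENNReal.mul_ne_top ENNReal.ofReal_ne_top ENNReal.ofReal_ne_top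

section DispDeriv

variable {i j : Fin 2} {a b s A C δ m : ℝ} {N : ℕ}

lemma hasCompactSupport_disp (hij : i ≠ j) (hA : 0 < A) (hC : 0 < C) (hδ : 0 < δ)
    (hN : N * δ = s) : HasCompactSupport (disp i j a b s A C δ N) := by
  refine HasCompactSupport.intro
    (K := closure (rect i j a (a + s) b (b + s))) (Bornology.IsBounded.isCompact_closure ?_)
    fun x hx => disp_eq_zero hA hC hδ hN fun h => hx (subset_closure h)
  refine (Metric.isBounded_closedBall (x := (0 : Plane))
    (r := |a| + |s| + (|b| + |s|))).subset fun x hx => ?_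
  obtain ⟨⟨h1, h2⟩, h3, h4⟩ := hx
  have e : x = x i • e2 i + x j • e2 j := by
    refine plane_ext hij ?_ ?_ <;> simp [e2_self, e2_of_ne hij, e2_of_ne hij.symm]
  have hi : |x i| ≤ |a| + |s| := by
    rw [abs_le]
    constructor <;> linarith [neg_abs_le a, le_abs_self a, le_abs_self s, abs_nonneg s]
  have hj : |x j| ≤ |b| + |s| := by
    rw [abs_le]
    constructor <;> linarith [neg_abs_le b, le_abs_self b, le_abs_self s, abs_nonneg s]
  rw [mem_closedBall_zero_iff, e]
  refine (norm_add_le _ _).trans (add_le_add ?_ ?_) <;> simpa [norm_smul, e2]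

lemma integral_lineDeriv_disp (hij : i ≠ j) (hA : 0 < A) (hC : 0 < C) (hδ : 0 < δ)
    (hN : N * δ = s) (v : Plane) :
    ∫ x in rect i j a (a + s) b (b + s), lineDeriv ℝ (disp i j a b s A C δ N) x v = 0 := by
  obtain ⟨K, hK⟩ := exists_lipschitz_disp i j a b s A C δ N
  rw [setIntegral_eq_integral_of_forall_compl_eq_zero fun x hx => ?_]
  · have h := (LipschitzWith.const (α := Plane) (1 : ℝ)).integral_lineDeriv_mul_eq (μ := volume) hK
      (hasCompactSupport_disp (a := a) (b := b) hij hA hC hδ hN) (-v)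
    simpa [lineDeriv] using h.symm
  · refine IsLocalMin.deriv_eq_zero (Filter.Eventually.of_forall fun t => ?_)
    simp only [zero_smul, add_zero, disp_eq_zero hA hC hδ hN hx]
    exact disp_nonneg _

lemma neg_one_le_lineDeriv_disp (hij : i ≠ j) (hA : 0 < A) (hC : 0 < C) (hC1 : C < 1) (x : Plane) :
    -1 ≤ lineDeriv ℝ (disp i j a b s A C δ N) x (e2 i) := by
  by_cases hd : LineDifferentiableAt ℝ (disp i j a b s A C δ N) x (e2 i)
  · have hmono : Monotone fun t : ℝ => disp i j a b s A C δ N (x + t • e2 i) + t := by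
      intro t t' h
      have h1 := disp_slope (i := i) (j := j) (a := a) (b := b) (s := s) (δ := δ) (N := N)
        (x := x + t • e2 i) (y := x + t' • e2 i) hA hC (by simp [e2_of_ne hij])
        (by simpa [e2_self] using h)
      simp only [PiLp.add_apply, PiLp.smul_apply, e2_self, smul_eq_mul] at h1
      nlinarith
    have h := (HasDerivAt.add hd.hasLineDerivAt (hasDerivAt_id 0)).deriv
    have := hmono.deriv_nonneg (x := 0)
    have h' : deriv (fun t : ℝ => disp i j a b s A C δ N (x + t • e2 i) + t) 0 = _ := h
    linarith
  · rw [lineDeriv_zero_of_not_lineDifferentiableAt hd]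
    norm_num

lemma abs_lineDeriv_disp_le (hij : i ≠ j) (x : Plane) :
    |lineDeriv ℝ (disp i j a b s A C δ N) x (e2 j)| ≤ 1 := by
  refine norm_deriv_le_of_lip' (f := fun t : ℝ => disp i j a b s A C δ N (x + t • e2 j))
    (x₀ := 0) zero_le_one (Filter.Eventually.of_forall fun t => ?_)
  have := abs_disp_sub_le (i := i) (j := j) (a := a) (b := b) (s := s) (A := A) (C := C) (δ := δ)
    (N := N) (x := x + t • e2 j) (y := x + (0 : ℝ) • e2 j) (by simp [e2_of_ne hij.symm])
  simpa [e2_self] using this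

lemma lineDeriv_disp_eq_zero (hij : i ≠ j) (hA : 0 < A) (hC : 0 < C) (hm : 0 < m)
    (hAC : A * m = C * (δ - m)) {x : Plane}
    (hx : x ∈ rect i j a (a + s) (b + A * m) (b + s - A * m)) :
    lineDeriv ℝ (disp i j a b s A C δ N) x (e2 j) = 0 := by
  have hsaw : ∀ y ∈ rect i j a (a + s) (b + A * m) (b + s - A * m),
      disp i j a b s A C δ N y = saw A C δ N (y i - a) := fun y hy => by
    have hH : 0 < A * m := by positivity
    obtain ⟨h1, h2, h3⟩ := hy
    rw [disp, bump_of_mem (by linarith) (by linarith)]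
    exact min_eq_left ((saw_le hA hC hm hAC N _).trans (le_min (by linarith) (by linarith)))
  have hev : disp i j a b s A C δ N =ᶠ[nhds x] fun y => saw A C δ N (y i - a) :=
    ((isOpen_rect ..).eventually_mem hx).mono hsaw
  rw [hev.lineDeriv_eq]
  simp [lineDeriv, e2_of_ne hij.symm]

lemma integral_abs_lineDeriv_disp_le (hij : i ≠ j) (hA : 0 < A) (hC : 0 < C) (hm : 0 < m)
    (hAC : A * m = C * (δ - m)) (hs : 2 * (A * m) < s) :
    ∫ x in rect i j a (a + s) b (b + s), |lineDeriv ℝ (disp i j a b s A C δ N) x (e2 j)| ≤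
      2 * (s * (A * m)) := by
  have hH : 0 < A * m := by positivity
  obtain ⟨K, hK⟩ := exists_lipschitz_disp i j a b s A C δ N
  set Q := rect i j a (a + s) b (b + s)
  set R := rect i j a (a + s) (b + A * m) (b + s - A * m)
  have hQ : MeasurableSet Q := (isOpen_rect ..).measurableSet
  have hR : MeasurableSet R := (isOpen_rect ..).measurableSet
  have hQf : volume Q ≠ ∞ := volume_rect_ne_top hij _ _ _ _
  have hRQ : R ⊆ Q := fun x hx => ⟨hx.1, by linarith [hx.2.1], by linarith [hx.2.2]⟩
  calc ∫ x in Q, |lineDeriv ℝ (disp i j a b s A C δ N) x (e2 j)|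
      ≤ ∫ x in Q, (Q \ R).indicator 1 x := by
        refine setIntegral_mono_on (integrableOn_lineDeriv hK hQf _).abs
          ((integrable_indicator_iff (hQ.diff hR)).2 ?_) hQ fun x hx => ?_
        · exact integrableOn_const (by
            exact ((Measure.restrict_apply_le _ _).trans_lt
              ((measure_mono sdiff_subset).trans_lt hQf.lt_top)).ne)
        · by_cases hxR : x ∈ R
          · rw [lineDeriv_disp_eq_zero hij hA hC hm hAC hxR, abs_zero]
            exact indicator_nonneg (fun _ _ => zero_le_one) x
          · rw [indicator_of_mem (show x ∈ Q \ R from ⟨hx, hxR⟩)]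
            exact abs_lineDeriv_disp_le hij x
    _ = volume.real (Q \ R) := by
        rw [setIntegral_indicator (hQ.diff hR), inter_eq_right.2 sdiff_subset]
        simp
    _ = 2 * (s * (A * m)) := by
        rw [measureReal_sdiff hRQ hR, measureReal_rect hij (by linarith) (by linarith),
          measureReal_rect hij (by linarith) (by linarith)]
        ring

end DispDeriv

/-! ### Variation of the building block -/

/-- The `ℓ¹` norm of a column of the linear part of `P`. -/
def colSum (P : Plane →ᵃ[ℝ] Plane) (l : Fin 2) : ℝ := ∑ k, |P.linear (e2 l) k|

lemma sum_eq_of_ne {i j : Fin 2} (hij : i ≠ j) (f : Fin 2 → ℝ) : ∑ l, f l = f i + f j := by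
  rcases eq_or_eq_of_ne hij 0 with rfl | rfl
  · obtain rfl : j = 1 := by omega
    exact Fin.sum_univ_two f
  · obtain rfl : i = 1 := by omega
    rw [Fin.sum_univ_two, add_comm]

lemma exists_sign (t : ℝ) : ∃ σ : ℝ, |σ| ≤ 1 ∧ σ * t = |t| := by
  rcases abs_cases t with ⟨h, _⟩ | ⟨h, _⟩
  · exact ⟨1, by simp, by simp [h]⟩
  · exact ⟨-1, by simp, by simp [h]⟩

lemma exists_lipschitz_affineMap (P : Plane →ᵃ[ℝ] Plane) : ∃ K, LipschitzWith K P := by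
  refine ⟨‖P.linear.toContinuousLinearMap‖₊, LipschitzWith.of_dist_le_mul fun x y => ?_⟩
  rw [dist_eq_norm, dist_eq_norm, ← vsub_eq_sub (P x), ← P.linearMap_vsub]
  exact P.linear.toContinuousLinearMap.le_opNorm _

lemma hasLineDerivAt_affineMap (P : Plane →ᵃ[ℝ] Plane) (k : Fin 2) (x v : Plane) :
    HasLineDerivAt ℝ (fun y => P y k) (P.linear v k) x v := by
  have h : ∀ t : ℝ, P (x + t • v) k = t * P.linear v k + P x k := fun t => by
    rw [add_comm, ← vadd_eq_add, P.map_vadd]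
    simp
  simp only [HasLineDerivAt, h]
  simpa using ((hasDerivAt_id (0 : ℝ)).mul_const (P.linear v k)).add_const (P x k)

/-- The variation of an affine map. -/
lemma Var_affineMap {i j : Fin 2} (hij : i ≠ j) (P : Plane →ᵃ[ℝ] Plane) {U : Set Plane}
    (hU : volume U ≠ ∞) (hUo : IsOpen U) :
    Var P U = (colSum P i + colSum P j) * volume.real U := by
  obtain ⟨K, hK⟩ := exists_lipschitz_affineMap P
  have hf : ∀ k, LipschitzWith (1 * K) fun x => P x k := fun k => (lipschitz_coord k).comp hK
  choose σ hσ hσ' using fun k l => exists_sign (P.linear (e2 l) k)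
  have h1 := Var_le hf hU
  have h2 := sum_integral_lineDeriv_le_Var hf hU hUo σ hσ
  have e : ∑ k, ∑ l, |P.linear (e2 l) k| * volume.real U =
      (colSum P i + colSum P j) * volume.real U := by
    simp only [colSum, sum_eq_of_ne hij]
    ring
  simp only [(hasLineDerivAt_affineMap P _ _ _).lineDeriv, setIntegral_const, smul_eq_mul] at h1 h2
  refine le_antisymm (h1.trans_eq ?_) (Eq.trans_le ?_ h2)
  · rw [← e]
    simp only [mul_comm]
  · rw [← e]
    refine Finset.sum_congr rfl fun k _ => Finset.sum_congr rfl fun l _ => ?_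
    rw [← hσ']
    ring

section ShearVar

variable {i j : Fin 2} {a b s A C δ m : ℝ} {N : ℕ}

lemma apply_shear (P : Plane →ᵃ[ℝ] Plane) (k : Fin 2) (x : Plane) :
    P (shear i j a b s A C δ N x) k = P x k + disp i j a b s A C δ N x * P.linear (e2 i) k := by
  rw [shear, add_comm, ← vadd_eq_add, P.map_vadd]
  simp [add_comm]

lemma exists_lipschitz_apply_shear (P : Plane →ᵃ[ℝ] Plane) :
    ∃ K, ∀ k, LipschitzWith K fun x => P (shear i j a b s A C δ N x) k := by
  obtain ⟨K, hK⟩ := exists_lipschitz_affineMap P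
  obtain ⟨K', hK'⟩ := exists_lipschitz_shear i j a b s A C δ N
  exact ⟨1 * (K * K'), fun k => (lipschitz_coord k).comp (hK.comp hK')⟩

lemma lineDeriv_apply_shear (P : Plane →ᵃ[ℝ] Plane) (v : Plane) : ∀ᵐ x, ∀ k,
    lineDeriv ℝ (fun y => P (shear i j a b s A C δ N y) k) x v =
      P.linear v k + lineDeriv ℝ (disp i j a b s A C δ N) x v * P.linear (e2 i) k := by
  obtain ⟨K, hK⟩ := exists_lipschitz_disp i j a b s A C δ N
  filter_upwards [hK.ae_lineDifferentiableAt (μ := volume) v] with x hx k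
  have h := HasDerivAt.add (hasLineDerivAt_affineMap P k x v)
    (HasDerivAt.mul_const hx.hasLineDerivAt (P.linear (e2 i) k))
  simp only [apply_shear]
  exact HasLineDerivAt.lineDeriv h

lemma integral_lineDeriv_apply_shear (P : Plane →ᵃ[ℝ] Plane) (v : Plane) (k : Fin 2)
    {U : Set Plane} (hU : volume U ≠ ∞) :
    ∫ x in U, lineDeriv ℝ (fun y => P (shear i j a b s A C δ N y) k) x v =
      P.linear v k * volume.real U +
        (∫ x in U, lineDeriv ℝ (disp i j a b s A C δ N) x v) * P.linear (e2 i) k := by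
  obtain ⟨K, hK⟩ := exists_lipschitz_disp i j a b s A C δ N
  have hc : IntegrableOn (fun _ => P.linear v k) U := integrableOn_const hU
  rw [integral_congr_ae ((ae_restrict_of_ae (lineDeriv_apply_shear P v)).mono fun x hx => hx k),
    integral_add hc ((integrableOn_lineDeriv hK hU v).mul_const _),
    integral_mul_const, setIntegral_const, smul_eq_mul, mul_comm (volume.real U)]

lemma le_Var_shear (hij : i ≠ j) (hA : 0 < A) (hC : 0 < C) (hδ : 0 < δ) (hN : N * δ = s)
    (hs : 0 ≤ s) (P : Plane →ᵃ[ℝ] Plane) :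
    (colSum P i + colSum P j) * s ^ 2 ≤
      Var (fun x => P (shear i j a b s A C δ N x)) (rect i j a (a + s) b (b + s)) := by
  obtain ⟨K, hK⟩ := exists_lipschitz_apply_shear (i := i) (j := j) (a := a) (b := b) (s := s)
    (A := A) (C := C) (δ := δ) (N := N) P
  have hQ : volume (rect i j a (a + s) b (b + s)) ≠ ∞ := volume_rect_ne_top hij _ _ _ _
  choose σ hσ hσ' using fun k l => exists_sign (P.linear (e2 l) k)
  refine le_trans (le_of_eq ?_) (sum_integral_lineDeriv_le_Var hK hQ (isOpen_rect ..) σ hσ)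
  simp only [integral_lineDeriv_apply_shear P _ _ hQ, integral_lineDeriv_disp hij hA hC hδ hN,
    zero_mul, add_zero, ← mul_assoc, hσ']
  rw [measureReal_rect hij (by linarith) (by linarith)]
  simp only [colSum, sum_eq_of_ne hij]
  ring

lemma Var_shear_le (hij : i ≠ j) (hA : 0 < A) (hC : 0 < C) (hC1 : C < 1) (hδ : 0 < δ)
    (hm : 0 < m) (hAC : A * m = C * (δ - m)) (hs : 2 * (A * m) < s) (hN : N * δ = s)
    (P : Plane →ᵃ[ℝ] Plane) :
    Var (fun x => P (shear i j a b s A C δ N x)) (rect i j a (a + s) b (b + s)) ≤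
      (colSum P i + colSum P j) * s ^ 2 + colSum P i * (2 * (s * (A * m))) := by
  have hs0 : 0 < s := by linarith [mul_pos hA hm]
  obtain ⟨K, hK⟩ := exists_lipschitz_apply_shear (i := i) (j := j) (a := a) (b := b) (s := s)
    (A := A) (C := C) (δ := δ) (N := N) P
  obtain ⟨K', hK'⟩ := exists_lipschitz_disp i j a b s A C δ N
  set Q := rect i j a (a + s) b (b + s)
  have hQ : volume Q ≠ ∞ := volume_rect_ne_top hij _ _ _ _
  have hvol : volume.real Q = s ^ 2 := by
    rw [measureReal_rect hij (by linarith) (by linarith)]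
    ring
  have hi : ∀ k, ∫ x in Q, |lineDeriv ℝ (fun y => P (shear i j a b s A C δ N y) k) x (e2 i)| =
      |P.linear (e2 i) k| * s ^ 2 := fun k => by
    have e : ∀ᵐ x ∂volume.restrict Q,
        |lineDeriv ℝ (fun y => P (shear i j a b s A C δ N y) k) x (e2 i)| =
          (1 + lineDeriv ℝ (disp i j a b s A C δ N) x (e2 i)) * |P.linear (e2 i) k| := by
      filter_upwards [ae_restrict_of_ae (lineDeriv_apply_shear P (e2 i))] with x hx
      rw [hx k, ← one_add_mul, abs_mul, abs_of_nonneg]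
      linarith [neg_one_le_lineDeriv_disp (a := a) (b := b) (s := s) (A := A) (δ := δ) (N := N)
        hij hA hC hC1 x]
    have hc : IntegrableOn (fun _ => (1 : ℝ)) Q := integrableOn_const hQ
    rw [integral_congr_ae e, integral_mul_const, integral_add hc
      (integrableOn_lineDeriv hK' hQ _), integral_lineDeriv_disp hij hA hC hδ hN, setIntegral_const,
      hvol, smul_eq_mul]
    ring
  have hj : ∀ k, ∫ x in Q, |lineDeriv ℝ (fun y => P (shear i j a b s A C δ N y) k) x (e2 j)| ≤
      |P.linear (e2 j) k| * s ^ 2 + 2 * (s * (A * m)) * |P.linear (e2 i) k| := fun k => by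
    have h1 := (integrableOn_lineDeriv hK' hQ (e2 j)).abs.mul_const |P.linear (e2 i) k|
    have h2 : IntegrableOn (fun _ => |P.linear (e2 j) k|) Q := integrableOn_const hQ
    calc ∫ x in Q, |lineDeriv ℝ (fun y => P (shear i j a b s A C δ N y) k) x (e2 j)|
        ≤ ∫ x in Q, (|P.linear (e2 j) k| +
            |lineDeriv ℝ (disp i j a b s A C δ N) x (e2 j)| * |P.linear (e2 i) k|) := by
          refine integral_mono_ae (integrableOn_lineDeriv (hK k) hQ _).abs (h2.add h1) ?_
          filter_upwards [ae_restrict_of_ae (lineDeriv_apply_shear P (e2 j))] with x hx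
          rw [hx k, ← abs_mul]
          exact abs_add_le _ _
      _ = |P.linear (e2 j) k| * s ^ 2 +
            (∫ x in Q, |lineDeriv ℝ (disp i j a b s A C δ N) x (e2 j)|) *
              |P.linear (e2 i) k| := by
          rw [integral_add h2 h1, integral_mul_const, setIntegral_const, hvol, smul_eq_mul,
            mul_comm (s ^ 2)]
      _ ≤ _ := by
          gcongr
          exact integral_abs_lineDeriv_disp_le hij hA hC hm hAC hs
  refine (Var_le hK hQ).trans ?_
  simp only [sum_eq_of_ne hij, hi, colSum]
  linarith [hj i, hj j]

lemma le_Var_shear_of_steep (hij : i ≠ j) {F : Set Plane} (hFo : IsOpen F)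
    (hF : volume F ≠ ∞)
    (hd : ∀ x ∈ F, ∃ c, ∀ᶠ y in nhds x, disp i j a b s A C δ N y = A * (y i - c))
    (P : Plane →ᵃ[ℝ] Plane) :
    colSum P i * ((1 + A) * volume.real F) ≤
      Var (fun x => P (shear i j a b s A C δ N x)) F := by
  obtain ⟨K, hK⟩ := exists_lipschitz_apply_shear (i := i) (j := j) (a := a) (b := b) (s := s)
    (A := A) (C := C) (δ := δ) (N := N) P
  have hdisp : ∫ x in F, lineDeriv ℝ (disp i j a b s A C δ N) x (e2 i) = A * volume.real F := by
    have : EqOn (fun x => lineDeriv ℝ (disp i j a b s A C δ N) x (e2 i)) (fun _ => A) F := by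
      intro x hx
      obtain ⟨c, hc⟩ := hd x hx
      have hc' : disp i j a b s A C δ N =ᶠ[nhds x] fun y => A * (y i - c) := hc
      have h : HasDerivAt (fun t : ℝ => A * ((x + t • e2 i) i - c)) (A * 1) 0 := by
        simp only [PiLp.add_apply, PiLp.smul_apply, e2_self, smul_eq_mul, mul_one]
        simpa using (((hasDerivAt_id (0 : ℝ)).const_add (x i)).sub_const c).const_mul A
      rw [mul_one] at h
      exact hc'.lineDeriv_eq.trans (HasLineDerivAt.lineDeriv h)
    rw [setIntegral_congr_fun hFo.measurableSet this, setIntegral_const, smul_eq_mul, mul_comm]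
  choose σ hσ hσ' using fun k => exists_sign (P.linear (e2 i) k)
  refine le_trans (le_of_eq ?_) (sum_integral_lineDeriv_le_Var hK hF hFo
    (fun k l => if l = i then σ k else 0) fun k l => ?_)
  · simp only [sum_eq_of_ne hij (fun l => (if l = i then σ _ else 0) * _), if_true, hij.symm,
      if_false, zero_mul, add_zero, integral_lineDeriv_apply_shear P _ _ hF, hdisp, colSum,
      Finset.sum_mul]
    refine Finset.sum_congr rfl fun k _ => ?_
    rw [← hσ']
    ring
  · split_ifs
    · exact hσ k
    · simp

end ShearVar

lemma colSum_pos (P : Plane →ᵃ[ℝ] Plane) (hP : Function.Injective P.linear) (i : Fin 2) :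
    0 < colSum P i := by
  refine (Finset.sum_nonneg fun k _ => abs_nonneg _).lt_of_ne' fun h => ?_
  have h0 := (Finset.sum_eq_zero_iff_of_nonneg fun k _ => abs_nonneg _).1 h
  have h1 : P.linear (e2 i) = P.linear 0 := by
    ext k
    simpa using h0 k (Finset.mem_univ k)
  have h2 := e2_self i
  rw [hP h1] at h2
  simp at h2

lemma steep_bound {θ c d s : ℝ} (hθ0 : 0 < θ) (hθ1 : θ ≤ 1 / 4) (hc : 0 < c) (hd : 0 < d)
    (hdc : d ≤ c) (hs : 0 < s) :
    (1 / 2 - 4 * θ) * ((c + d) * s ^ 2) < c * ((1 - θ) ^ 3 * s ^ 2) := by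
  have h2 : 1 - 3 * θ ≤ (1 - θ) ^ 3 := by nlinarith [sq_nonneg θ]
  have h3 : (1 / 2 - 4 * θ) * (c + d) < c * (1 - 3 * θ) := by
    rcases le_total 0 (1 / 2 - 4 * θ) with h | h <;> nlinarith
  have h4 : c * (1 - 3 * θ) ≤ c * (1 - θ) ^ 3 := mul_le_mul_of_nonneg_left h2 hc.le
  rw [← mul_assoc, ← mul_assoc]
  exact mul_lt_mul_of_pos_right (h3.trans_le h4) (by positivity)

/-- The building block, sheared in the direction of the larger column of the linear part. -/
lemma exists_building_block {i j : Fin 2} (hij : i ≠ j) (P : Plane →ᵃ[ℝ] Plane)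
    (hP : Function.Bijective P.linear) (hcol : colSum P j ≤ colSum P i) {a b s : ℝ} (hs : 0 < s)
    {n : ℕ} (hn : 1 ≤ n) {Q : Set Plane} (hQ : Q = rect i j a (a + s) b (b + s)) :
    ∃ (h hinv : Plane → Plane) (F : Set Plane),
      PiecewiseAffineOn h Q ∧
      IsHomeoOn h hinv Q (⇑P '' Q) ∧
      ContinuousOn h (closure Q) ∧ EqOn h (⇑P) (frontier Q) ∧
      |Var h Q - Var (⇑P) Q| ≤ (1 / n : ℝ) * Var (⇑P) Q ∧
      F ⊆ Q ∧ FinUnionTriangles F ∧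
      volume F < volume Q / (n : ℝ≥0∞) ∧
      (1 / 2 - 1 / n : ℝ) * Var (⇑P) Q < Var h F := by
  have hn1 : (1 : ℝ) ≤ n := by exact_mod_cast hn
  have hn0 : (0 : ℝ) < n := by linarith
  obtain ⟨θ, hθ⟩ : ∃ θ : ℝ, θ = 1 / (4 * n) := ⟨_, rfl⟩
  have hθ0 : 0 < θ := by rw [hθ]; positivity
  have hθ1 : θ ≤ 1 / 4 := by
    rw [hθ]
    exact one_div_le_one_div_of_le (by norm_num) (by linarith)
  have hnθ : (1 / n : ℝ) = 4 * θ := by rw [hθ]; field_simp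
  obtain ⟨N, hN⟩ : ∃ N : ℕ, N = 8 * n := ⟨_, rfl⟩
  have hN0 : (0 : ℝ) < N := by rw [hN]; push_cast; positivity
  obtain ⟨δ, hδ⟩ : ∃ δ : ℝ, δ = s / N := ⟨_, rfl⟩
  have hδ0 : 0 < δ := by rw [hδ]; positivity
  have hNδ : N * δ = s := by rw [hδ]; field_simp
  have hδθ : 2 * δ = θ * s := by
    rw [hδ, hθ, hN]
    push_cast
    field_simp
    norm_num
  obtain ⟨m, hm⟩ : ∃ m, m = θ * δ := ⟨_, rfl⟩
  have hm0 : 0 < m := by rw [hm]; positivity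
  have hmδ : m < δ := by rw [hm]; nlinarith
  obtain ⟨C, hC⟩ : ∃ C, C = 1 - θ := ⟨_, rfl⟩
  have hC0 : 0 < C := by linarith
  have hC1 : C < 1 := by linarith
  obtain ⟨A, hA⟩ : ∃ A, A = (1 - θ) ^ 2 / θ := ⟨_, rfl⟩
  have hAθ : A * θ = (1 - θ) ^ 2 := by rw [hA]; field_simp
  have hA0 : 0 < A := by rw [hA]; exact div_pos (by nlinarith) hθ0
  have hAm : A * m = (1 - θ) ^ 2 * δ := by rw [hm, ← mul_assoc, hAθ]
  have hAC : A * m = C * (δ - m) := by rw [hAm, hC, hm]; ring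
  have hH : A * m ≤ δ := by rw [hAm]; nlinarith
  have hHs : 2 * (A * m) ≤ θ * s := by linarith
  have hs2 : 2 * (A * m) < s := by nlinarith
  have hQo : IsOpen Q := hQ ▸ isOpen_rect ..
  have hQf : volume Q ≠ ∞ := hQ ▸ volume_rect_ne_top hij _ _ _ _
  have hvol : volume.real Q = s ^ 2 := by
    rw [hQ, measureReal_rect hij (by linarith) (by linarith)]
    ring
  have hi := colSum_pos P hP.1 i
  have hj := colSum_pos P hP.1 j
  have hVP := Var_affineMap hij P hQf hQo
  rw [hvol] at hVP
  obtain ⟨hinv, hhomeo⟩ :=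
    exists_isHomeoOn_shear (a := a) (b := b) hij hA0 hC0 hC1 hm0 hδ0 hAC hNδ P hP
  obtain ⟨F, hFo, hFt, hFQ, hFd, hFle, hFge⟩ := exists_active_set (a := a) (b := b) (N := N) hij
    hA0 hC0 hδ0 hm0 hmδ hAC hs2 le_rfl
  rw [hNδ, ← hQ] at hFQ
  have hFf : volume F ≠ ∞ := ((measure_mono hFQ).trans_lt hQf.lt_top).ne
  refine ⟨_, hinv, F, hQ ▸ piecewiseAffineOn_shear hij hA0 hC0 hδ0 hm0 hmδ hAC hs2 hNδ P,
    hQ ▸ hhomeo, ?_, ?_, ?_, hFQ, hFt, ?_, ?_⟩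
  · obtain ⟨K, hK⟩ := exists_lipschitz_affineMap P
    obtain ⟨K', hK'⟩ := exists_lipschitz_shear i j a b s A C δ N
    exact (hK.continuous.comp hK'.continuous).continuousOn
  · intro x hx
    rw [hQo.frontier_eq, hQ] at hx
    exact congrArg P (shear_eq_self hA0 hC0 hδ0 hNδ hx.2)
  · have h1 := le_Var_shear (a := a) (b := b) hij hA0 hC0 hδ0 hNδ hs.le P
    have h2 := Var_shear_le (a := a) (b := b) hij hA0 hC0 hC1 hδ0 hm0 hAC hs2 hNδ P
    rw [← hQ] at h1 h2
    rw [hVP, hnθ, abs_of_nonneg (by linarith)]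
    have h3 : colSum P i * (2 * (s * (A * m))) ≤ colSum P i * (θ * s ^ 2) := by
      refine mul_le_mul_of_nonneg_left ?_ hi.le
      linarith [mul_le_mul_of_nonneg_left hHs hs.le]
    have h4 : 0 < θ * s ^ 2 := by positivity
    nlinarith [mul_pos hi h4, mul_pos hj h4]
  · have e : (N : ℝ) * (m * s) = θ * s ^ 2 := by rw [hm, ← hNδ]; ring
    rw [e] at hFle
    refine hFle.trans_lt ?_
    rw [← ofReal_measureReal hQf, hvol, ← ENNReal.ofReal_natCast, ← ENNReal.ofReal_div_of_pos hn0,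
      ENNReal.ofReal_lt_ofReal_iff (by positivity), div_eq_mul_one_div, hnθ]
    nlinarith [show 0 < θ * s ^ 2 by positivity]
  · refine lt_of_lt_of_le ?_ (le_Var_shear_of_steep hij hFo hFf hFd P)
    rw [hVP, hnθ]
    have e : (N : ℝ) * (m * (s - 2 * (A * m))) = θ * s * (s - 2 * (A * m)) := by
      rw [hm]
      linear_combination θ * (s - 2 * (A * (θ * δ))) * hNδ
    rw [e] at hFge
    have hFr : θ * s * (s - 2 * (A * m)) ≤ volume.real F :=
      (ENNReal.ofReal_le_iff_le_toReal hFf).1 hFge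
    have h1 : (1 - θ) ^ 3 * s ^ 2 ≤ (1 + A) * volume.real F := by
      have g1 : (1 - θ) ^ 3 * s ^ 2 = A * (θ * s * (s - θ * s)) := by
        linear_combination -(1 - θ) * s ^ 2 * hAθ
      have g2 : A * (θ * s * (s - θ * s)) ≤ A * volume.real F := by
        refine mul_le_mul_of_nonneg_left (le_trans ?_ hFr) hA0.le
        exact mul_le_mul_of_nonneg_left (by linarith) (by positivity)
      linarith [measureReal_nonneg (μ := volume) (s := F)]
    exact (steep_bound hθ0 hθ1 hi hj hcol hs).trans_le (mul_le_mul_of_nonneg_left h1 hi.le)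

/-- for every affine homeomorphism `P` on an open axis-parallel square
`Q0` and every `n ≥ 1` there is a piecewise affine homeomorphism `h : Q0 → P(Q0)`
agreeing with `P` on `∂Q0` with `|Var(h,Q0) - Var(P,Q0)| ≤ (1/n)·Var(P,Q0)`,
together with a finite union `F` of pairwise disjoint open triangles in `Q0` with
`|F| < |Q0|/n` and `Var(h,F) > (1/2 - 1/n)·Var(P,Q0)`. -/
theorem building_block_variation (P : Plane →ᵃ[ℝ] Plane)
    (hP : Function.Bijective P.linear)
    (Q0 : Set Plane) (hQ0 : IsOpenAxisSquare Q0) (n : ℕ) (hn : 1 ≤ n) :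
    ∃ (h hinv : Plane → Plane) (F : Set Plane),
      PiecewiseAffineOn h Q0 ∧
      IsHomeoOn h hinv Q0 (⇑P '' Q0) ∧
      ContinuousOn h (closure Q0) ∧ EqOn h (⇑P) (frontier Q0) ∧
      |Var h Q0 - Var (⇑P) Q0| ≤ (1 / n : ℝ) * Var (⇑P) Q0 ∧
      F ⊆ Q0 ∧ FinUnionTriangles F ∧
      volume F < volume Q0 / (n : ℝ≥0∞) ∧
      (1 / 2 - 1 / n : ℝ) * Var (⇑P) Q0 < Var h F := by
  obtain ⟨a, b, s, hs, hQ⟩ := hQ0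
  rcases le_total (colSum P 1) (colSum P 0) with hcol | hcol
  · refine exists_building_block zero_ne_one P hP hcol hs hn (a := a) (b := b) (hQ.trans ?_)
    ext x
    simp only [rect, mem_ofPred_eq, and_assoc]
  · refine exists_building_block one_ne_zero P hP hcol hs hn (a := b) (b := a) (hQ.trans ?_)
    ext x
    simp only [rect, mem_ofPred_eq]
    tauto

end
end

section
/- Let Q=(0,1)² and let f : Q → Q be a BV homeomorphism of Q onto Q which extends continuously to the closure of Q with f = Id on ∂Q and which satisfies Var(f,Q) > 2. Then for every ε > 0 there exists a BV homeomorphism g : Q → Q, extending continuously to the identity on ∂Q, such that ‖g−f‖_∞ + ‖g⁻¹−f⁻¹‖_∞ < ε and Var(g,Q) < Var(f,Q). -/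
open MeasureTheory Set
open scoped ENNReal

noncomputable section

section Geometry

/-- The open square `(a,b)²`. -/
def openBox (a b : ℝ) : Set Plane := {x | ∀ i, x i ∈ Ioo a b}

theorem unitSq_eq_openBox : unitSq = openBox 0 1 := by
  ext x
  simp [unitSq, openBox, Fin.forall_fin_two, and_assoc]

theorem openBox_eq_preimage (a b : ℝ) :
    openBox a b = WithLp.ofLp ⁻¹' (univ.pi fun _ : Fin 2 => Ioo a b) := by
  ext x
  simp [openBox]

theorem isOpen_openBox (a b : ℝ) : IsOpen (openBox a b) := by
  rw [openBox_eq_preimage]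
  exact (isOpen_set_pi finite_univ fun _ _ => isOpen_Ioo).preimage
    (PiLp.continuous_ofLp 2 _)

theorem volume_openBox (a b : ℝ) : volume (openBox a b) = ENNReal.ofReal (b - a) ^ 2 := by
  rw [openBox_eq_preimage, (PiLp.volume_preserving_ofLp (Fin 2)).measure_preimage
    (MeasurableSet.univ_pi fun _ => measurableSet_Ioo).nullMeasurableSet]
  simp [Real.volume_pi_Ioo]

theorem measureReal_openBox {a b : ℝ} (h : a ≤ b) :
    volume.real (openBox a b) = (b - a) ^ 2 := by
  rw [Measure.real, volume_openBox, ENNReal.toReal_pow, ENNReal.toReal_ofReal (by linarith)]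

theorem openBox_subset_openBox {a b a' b' : ℝ} (ha : a' ≤ a) (hb : b ≤ b') :
    openBox a b ⊆ openBox a' b' :=
  fun _ hx i => ⟨ha.trans_lt (hx i).1, (hx i).2.trans_le hb⟩

theorem isOpen_unitSq : IsOpen unitSq := unitSq_eq_openBox ▸ isOpen_openBox 0 1

theorem isCompact_closedBox (a b : ℝ) : IsCompact {x : Plane | ∀ i, x i ∈ Icc a b} := by
  have h : {x : Plane | ∀ i, x i ∈ Icc a b} =
      (PiLp.homeomorph 2 fun _ : Fin 2 => ℝ) ⁻¹' (univ.pi fun _ => Icc a b) := by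
    ext x
    simp only [mem_ofPred_eq, mem_preimage, mem_univ_pi]
    rfl
  rw [h, Homeomorph.isCompact_preimage]
  exact isCompact_univ_pi fun _ => isCompact_Icc

theorem isCompact_closure_unitSq : IsCompact (closure unitSq) := by
  refine (isCompact_closedBox 0 1).closure_of_subset ?_
  rw [unitSq_eq_openBox]
  exact fun x hx i => Ioo_subset_Icc_self (hx i)

theorem volume_unitSq_lt_top : volume unitSq < ∞ :=
  (measure_mono subset_closure).trans_lt isCompact_closure_unitSq.measure_lt_top

theorem inv_smul_mem_unitSq {r : ℝ} (hr : 0 < r) (x : Plane) :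
    r⁻¹ • x ∈ unitSq ↔ x ∈ openBox 0 r := by
  rw [unitSq_eq_openBox]
  refine forall_congr' fun i => ?_
  rw [PiLp.smul_apply, smul_eq_mul, mem_Ioo, mem_Ioo, inv_mul_lt_iff₀ hr, mul_one,
    mul_pos_iff_of_pos_left (inv_pos.2 hr)]

theorem smul_mem_openBox {r : ℝ} (hr : 0 < r) {x : Plane} (hx : x ∈ unitSq) :
    r • x ∈ openBox 0 r := by
  rwa [← inv_smul_mem_unitSq hr, inv_smul_smul₀ hr.ne']

theorem openBox_subset_unitSq {r : ℝ} (hr : r ≤ 1) : openBox 0 r ⊆ unitSq :=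
  unitSq_eq_openBox ▸ openBox_subset_openBox le_rfl hr

end Geometry

section Homeomorphisms

open Classical in
/-- A homeomorphism of the unit square fixing the boundary, extended by the identity,
is a homeomorphism of the plane. -/
theorem exists_homeomorph_extension {f finv : Plane → Plane}
    (hf : IsHomeoOn f finv unitSq unitSq) (hext : ExtendsToId f) :
    ∃ H : Plane ≃ₜ Plane, EqOn H f unitSq ∧ EqOn H.symm finv unitSq ∧
      EqOn H id unitSqᶜ := by
  obtain ⟨hbij, -, hinv, -⟩ := hf
  set F : Plane → Plane := unitSq.piecewise f id
  have hin : ∀ x ∈ unitSq, F x = f x := fun x hx => piecewise_eq_of_mem _ _ _ hx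
  have hout : ∀ x ∉ unitSq, F x = x := fun x hx => piecewise_eq_of_notMem _ _ _ hx
  have hcont : Continuous F :=
    continuous_piecewise (fun a ha => hext.2 ha) hext.1 continuousOn_id
  have hev : (fun x => x) =ᶠ[Filter.cocompact Plane] F := by
    filter_upwards [isCompact_closure_unitSq.compl_mem_cocompact] with x hx
    exact (hout x fun h => hx (subset_closure h)).symm
  have hproper : IsProperMap F :=
    isProperMap_iff_tendsto_cocompact.2 ⟨hcont, Filter.tendsto_id.congr' hev⟩
  have hinj : Function.Injective F := by
    intro x y hxy
    by_cases hx : x ∈ unitSq <;> by_cases hy : y ∈ unitSq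
    · rw [hin x hx, hin y hy] at hxy
      exact hbij.injOn hx hy hxy
    · rw [hin x hx, hout y hy] at hxy
      exact absurd (hxy ▸ hbij.mapsTo hx) hy
    · rw [hout x hx, hin y hy] at hxy
      exact absurd (hxy ▸ hbij.mapsTo hy) hx
    · rwa [hout x hx, hout y hy] at hxy
  have hsurj : Function.Surjective F := by
    intro y
    by_cases hy : y ∈ unitSq
    · obtain ⟨x, hx, rfl⟩ := hbij.surjOn hy
      exact ⟨x, hin x hx⟩
    · exact ⟨y, hout y hy⟩
  let H : Plane ≃ₜ Plane := (isHomeomorph_iff_continuous_isClosedMap_bijective.2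
    ⟨hcont, hproper.isClosedMap, hinj, hsurj⟩).homeomorph
  refine ⟨H, hin, fun y hy => ?_, hout⟩
  rw [Homeomorph.symm_apply_eq]
  have hy' : finv y ∈ unitSq := by
    obtain ⟨x, hx, rfl⟩ := hbij.surjOn hy
    rwa [hinv.1 hx]
  exact ((hin _ hy').trans (hinv.2 hy)).symm

/-- Conjugation of a map by the dilation of ratio `r`. -/
def dilate (r : ℝ) (F : Plane → Plane) (x : Plane) : Plane := r • F (r⁻¹ • x)

theorem continuous_dilate (r : ℝ) {F : Plane → Plane} (hF : Continuous F) :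
    Continuous (dilate r F) := by
  unfold dilate
  fun_prop

theorem dilate_eq_self {r : ℝ} (hr : 0 < r) {F : Plane → Plane}
    (hF : EqOn F id unitSqᶜ) {x : Plane} (hx : x ∉ openBox 0 r) : dilate r F x = x := by
  rw [← inv_smul_mem_unitSq hr] at hx
  rw [dilate, hF hx, id, smul_inv_smul₀ hr.ne']

theorem mapsTo_dilate {r : ℝ} (hr : 0 < r) (hr1 : r ≤ 1) {F : Plane → Plane}
    (hF : EqOn F id unitSqᶜ) (hmaps : MapsTo F unitSq unitSq) :
    MapsTo (dilate r F) unitSq unitSq := by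
  intro x hx
  by_cases h : x ∈ openBox 0 r
  · exact openBox_subset_unitSq hr1
      (smul_mem_openBox hr (hmaps ((inv_smul_mem_unitSq hr x).2 h)))
  · rwa [dilate_eq_self hr hF h]

theorem dilate_leftInverse {r : ℝ} (hr : 0 < r) {F G : Plane → Plane}
    (h : Function.LeftInverse G F) : Function.LeftInverse (dilate r G) (dilate r F) := by
  intro x
  simp only [dilate]
  rw [inv_smul_smul₀ hr.ne', h, smul_inv_smul₀ hr.ne']

theorem extendsToId_dilate {r : ℝ} (hr : 0 < r) (hr1 : r ≤ 1) {F : Plane → Plane}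
    (hc : Continuous F) (hF : EqOn F id unitSqᶜ) : ExtendsToId (dilate r F) := by
  refine ⟨(continuous_dilate r hc).continuousOn, fun x hx => dilate_eq_self hr hF fun h => ?_⟩
  rw [isOpen_unitSq.frontier_eq] at hx
  exact hx.2 (openBox_subset_unitSq hr1 h)

theorem isHomeoOn_dilate {r : ℝ} (hr : 0 < r) (hr1 : r ≤ 1) (H : Plane ≃ₜ Plane)
    (hid : EqOn H id unitSqᶜ) :
    IsHomeoOn (dilate r H) (dilate r H.symm) unitSq unitSq := by
  have hid' : EqOn H.symm id unitSqᶜ := fun x hx => by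
    rw [Homeomorph.symm_apply_eq]
    exact (hid hx).symm
  have hmaps : MapsTo H unitSq unitSq := fun x hx => by
    by_contra h
    have := hid h
    exact h ((H.injective this).symm ▸ hx)
  have hmaps' : MapsTo H.symm unitSq unitSq := fun x hx => by
    by_contra h
    have := hid' h
    exact h ((H.symm.injective this).symm ▸ hx)
  have hinv : InvOn (dilate r H.symm) (dilate r H) unitSq unitSq :=
    ⟨(dilate_leftInverse hr H.symm_apply_apply).leftInvOn _,
      (dilate_leftInverse hr H.apply_symm_apply).leftInvOn _⟩
  exact ⟨hinv.bijOn (mapsTo_dilate hr hr1 hid hmaps) (mapsTo_dilate hr hr1 hid' hmaps'),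
    (continuous_dilate r H.continuous).continuousOn, hinv,
    (continuous_dilate r H.symm.continuous).continuousOn⟩

theorem eventually_supDist_dilate_le {F f : Plane → Plane} (hF : Continuous F)
    (hFf : EqOn F f unitSq) {δ : ℝ} (hδ : 0 < δ) :
    ∀ᶠ r in nhds (1 : ℝ), supDist (dilate r F) f unitSq ≤ δ := by
  have key : ∀ᶠ r in nhds (1 : ℝ), ∀ x ∈ closure unitSq, dist (dilate r F x) (F x) < δ := by
    refine isCompact_closure_unitSq.eventually_forall_of_forall_eventually fun x _ => ?_
    have hc : ContinuousAt (fun z : ℝ × Plane => dist (dilate z.1 F z.2) (F z.2)) (1, x) := by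
      have hinv : ContinuousAt (fun z : ℝ × Plane => z.1⁻¹ • z.2) (1, x) :=
        (continuousAt_fst.inv₀ one_ne_zero).smul continuousAt_snd
      exact (continuousAt_fst.smul (hF.continuousAt.comp hinv)).dist
        (hF.continuousAt.comp continuousAt_snd)
    refine hc.eventually_lt continuousAt_const ?_
    simpa [dilate] using hδ
  filter_upwards [key] with r hr
  refine Real.iSup_le (fun x => ?_) hδ.le
  rw [← hFf x.2]
  exact (hr x (subset_closure x.2)).le

end Homeomorphisms

section Pairing

/-- The density of the pairing of a map `v` with the divergence of a test field `φ`. -/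
def dualPairing (v : Plane → Plane) (φ : Plane → Plane × Plane) (x : Plane) : ℝ :=
  (v x 0) * (fderiv ℝ (fun y => (φ y).1 0) x (e2 0)
      + fderiv ℝ (fun y => (φ y).1 1) x (e2 1))
    + (v x 1) * (fderiv ℝ (fun y => (φ y).2 0) x (e2 0)
      + fderiv ℝ (fun y => (φ y).2 1) x (e2 1))

/-- The trace of a matrix field. -/
def fieldTrace (φ : Plane → Plane × Plane) (x : Plane) : ℝ := (φ x).1 0 + (φ x).2 1

/-- The components of a matrix field are bounded by `1`. -/
def BoundedByOne (φ : Plane → Plane × Plane) : Prop :=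
  ∀ x i, |(φ x).1 i| ≤ 1 ∧ |(φ x).2 i| ≤ 1

variable {φ : Plane → Plane × Plane} {v w : Plane → Plane}

theorem contDiff_fst_apply (hφ : ContDiff ℝ 1 φ) (i : Fin 2) :
    ContDiff ℝ 1 fun y => (φ y).1 i :=
  contDiff_euclidean.1 hφ.fst i

theorem contDiff_snd_apply (hφ : ContDiff ℝ 1 φ) (i : Fin 2) :
    ContDiff ℝ 1 fun y => (φ y).2 i :=
  contDiff_euclidean.1 hφ.snd i

theorem hasCompactSupport_fst_apply (hφ : HasCompactSupport φ) (i : Fin 2) :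
    HasCompactSupport fun y => (φ y).1 i :=
  hφ.comp_left (g := fun z : Plane × Plane => z.1 i) rfl

theorem hasCompactSupport_snd_apply (hφ : HasCompactSupport φ) (i : Fin 2) :
    HasCompactSupport fun y => (φ y).2 i :=
  hφ.comp_left (g := fun z : Plane × Plane => z.2 i) rfl

theorem continuous_fderiv_apply_const {a : Plane → ℝ} (ha : ContDiff ℝ 1 a) (e : Plane) :
    Continuous fun x => fderiv ℝ a x e :=
  (ha.continuous_fderiv one_ne_zero).clm_apply continuous_const

theorem continuous_dualPairing (hφ : ContDiff ℝ 1 φ) (hv : Continuous v) :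
    Continuous (dualPairing v φ) := by
  have h1 := fun i j => continuous_fderiv_apply_const (contDiff_fst_apply hφ i) (e2 j)
  have h2 := fun i j => continuous_fderiv_apply_const (contDiff_snd_apply hφ i) (e2 j)
  have hv' : ∀ i, Continuous fun x => v x i := fun i => by fun_prop
  exact ((hv' 0).mul ((h1 0 0).add (h1 1 1))).add ((hv' 1).mul ((h2 0 0).add (h2 1 1)))

theorem continuous_fieldTrace (hφ : ContDiff ℝ 1 φ) : Continuous (fieldTrace φ) :=
  (contDiff_fst_apply hφ 0).continuous.add (contDiff_snd_apply hφ 1).continuous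

theorem abs_fieldTrace_le (hφ : BoundedByOne φ) (x : Plane) : |fieldTrace φ x| ≤ 2 :=
  (abs_add_le _ _).trans (by linarith [(hφ x 0).1, (hφ x 1).2])

theorem Continuous.integrableOn_unitSq {E : Type*} [NormedAddCommGroup E] {F : Plane → E}
    (hF : Continuous F) : IntegrableOn F unitSq :=
  (hF.continuousOn.integrableOn_compact isCompact_closure_unitSq).mono_set subset_closure

theorem dualPairing_sub (x : Plane) :
    dualPairing (fun y => v y - w y) φ x = dualPairing v φ x - dualPairing w φ x := by
  simp only [dualPairing, PiLp.sub_apply]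
  ring

theorem fderiv_coord (i : Fin 2) (x e : Plane) :
    fderiv ℝ (fun y : Plane => y i) x e = e i := by
  have : HasFDerivAt (fun y : Plane => y i) (EuclideanSpace.proj i : Plane →L[ℝ] ℝ) x :=
    (EuclideanSpace.proj i : Plane →L[ℝ] ℝ).hasFDerivAt
  rw [this.fderiv]
  rfl

theorem integrable_coord_mul_fderiv {a : Plane → ℝ} (ha : ContDiff ℝ 1 a)
    (hs : HasCompactSupport a) (i : Fin 2) (e : Plane) :
    Integrable fun x : Plane => x i * fderiv ℝ a x e :=
  ((show Continuous fun x : Plane => x i by fun_prop).mul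
    (continuous_fderiv_apply_const ha e)).integrable_of_hasCompactSupport
    (hs.fderiv_apply ℝ e).mul_left

theorem integral_coord_mul_fderiv {a : Plane → ℝ} (ha : ContDiff ℝ 1 a)
    (hs : HasCompactSupport a) (i : Fin 2) (e : Plane) :
    ∫ x : Plane, x i * fderiv ℝ a x e = -(e i * ∫ x, a x) := by
  have hc : Continuous fun x : Plane => x i := by fun_prop
  rw [integral_mul_fderiv_eq_neg_fderiv_mul_of_integrable]
  · simp only [fderiv_coord, integral_const_mul]
  · simp only [fderiv_coord]
    exact (ha.continuous.integrable_of_hasCompactSupport hs).const_mul _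
  · exact integrable_coord_mul_fderiv ha hs i e
  · exact (hc.mul ha.continuous).integrable_of_hasCompactSupport hs.mul_left
  · exact fun x _ => (EuclideanSpace.proj i : Plane →L[ℝ] ℝ).differentiableAt
  · exact fun x _ => ha.differentiable one_ne_zero x

theorem integral_dualPairing_id (hφ : ContDiff ℝ 1 φ) (hs : HasCompactSupport φ) :
    ∫ x, dualPairing (fun y => y) φ x = -∫ x, fieldTrace φ x := by
  have h1 := fun i => contDiff_fst_apply hφ i
  have h2 := fun i => contDiff_snd_apply hφ i
  have s1 := fun i => hasCompactSupport_fst_apply hs i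
  have s2 := fun i => hasCompactSupport_snd_apply hs i
  have I1 := fun i j => integrable_coord_mul_fderiv (h1 i) (s1 i) j (e2 i)
  have I2 := fun i j => integrable_coord_mul_fderiv (h2 i) (s2 i) j (e2 i)
  have J1 : Integrable fun x : Plane => x 0 * fderiv ℝ (fun y => (φ y).1 0) x (e2 0) +
      x 0 * fderiv ℝ (fun y => (φ y).1 1) x (e2 1) := (I1 0 0).add (I1 1 0)
  have J2 : Integrable fun x : Plane => x 1 * fderiv ℝ (fun y => (φ y).2 0) x (e2 0) +
      x 1 * fderiv ℝ (fun y => (φ y).2 1) x (e2 1) := (I2 0 1).add (I2 1 1)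
  simp only [dualPairing, fieldTrace, mul_add]
  rw [integral_add J1 J2,
    integral_add (I1 0 0) (I1 1 0), integral_add (I2 0 1) (I2 1 1),
    integral_coord_mul_fderiv (h1 0) (s1 0), integral_coord_mul_fderiv (h1 1) (s1 1),
    integral_coord_mul_fderiv (h2 0) (s2 0), integral_coord_mul_fderiv (h2 1) (s2 1),
    integral_add ((h1 0).continuous.integrable_of_hasCompactSupport (s1 0))
      ((h2 1).continuous.integrable_of_hasCompactSupport (s2 1))]
  simp [e2]
  ring

theorem dualPairing_eq_zero_of_notMem_tsupport {x : Plane} (hx : x ∉ tsupport φ) :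
    dualPairing v φ x = 0 := by
  have h : ∀ g : Plane × Plane → ℝ, g 0 = 0 → fderiv ℝ (fun y => g (φ y)) x = 0 := by
    intro g hg
    exact fderiv_of_notMem_tsupport ℝ fun h =>
      hx (closure_mono (Function.support_comp_subset hg φ) h)
  simp [dualPairing, h (fun z => z.1 0) rfl, h (fun z => z.1 1) rfl,
    h (fun z => z.2 0) rfl, h (fun z => z.2 1) rfl]

theorem fieldTrace_eq_zero_of_notMem_tsupport {x : Plane} (hx : x ∉ tsupport φ) :
    fieldTrace φ x = 0 := by
  simp [fieldTrace, image_eq_zero_of_notMem_tsupport hx]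

theorem setIntegral_dualPairing_id (hφ : ContDiff ℝ 1 φ) (hs : HasCompactSupport φ)
    (hsupp : tsupport φ ⊆ unitSq) :
    ∫ x in unitSq, dualPairing (fun y => y) φ x = -∫ x in unitSq, fieldTrace φ x := by
  rw [setIntegral_eq_integral_of_forall_compl_eq_zero,
    setIntegral_eq_integral_of_forall_compl_eq_zero, integral_dualPairing_id hφ hs]
  · exact fun x hx => fieldTrace_eq_zero_of_notMem_tsupport fun h => hx (hsupp h)
  · exact fun x hx => dualPairing_eq_zero_of_notMem_tsupport fun h => hx (hsupp h)

theorem setIntegral_dualPairing_sub_id_le {F : Plane → Plane} (hF : Continuous F)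
    (hB : BddAbove (varSet F unitSq)) (hφ : ContDiff ℝ 1 φ) (hs : HasCompactSupport φ)
    (hsupp : tsupport φ ⊆ unitSq) (h1 : BoundedByOne φ) :
    ∫ x in unitSq, dualPairing (fun y => F y - y) φ x ≤
      Var F unitSq + ∫ x in unitSq, fieldTrace φ x := by
  have hV : ∫ x in unitSq, dualPairing F φ x ≤ Var F unitSq :=
    le_csSup hB ⟨φ, hφ, hs, hsupp, h1, rfl⟩
  simp only [dualPairing_sub]
  rw [integral_sub (continuous_dualPairing hφ hF).integrableOn_unitSq
    (continuous_dualPairing hφ continuous_id').integrableOn_unitSq,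
    setIntegral_dualPairing_id hφ hs hsupp]
  linarith

theorem dualPairing_smul {χ : Plane → ℝ} (hχ : ContDiff ℝ 1 χ) (hφ : ContDiff ℝ 1 φ)
    (x : Plane) :
    dualPairing v (fun y => χ y • φ y) x = χ x * dualPairing v φ x +
      ((v x 0) * (fderiv ℝ χ x (e2 0) * (φ x).1 0 + fderiv ℝ χ x (e2 1) * (φ x).1 1) +
        (v x 1) * (fderiv ℝ χ x (e2 0) * (φ x).2 0 + fderiv ℝ χ x (e2 1) * (φ x).2 1)) := by
  have key : ∀ a : Plane → ℝ, ContDiff ℝ 1 a → ∀ e : Plane,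
      fderiv ℝ (fun y => χ y * a y) x e = χ x * fderiv ℝ a x e + fderiv ℝ χ x e * a x := by
    intro a ha e
    rw [fderiv_fun_mul (hχ.differentiable one_ne_zero x) (ha.differentiable one_ne_zero x)]
    simp [mul_comm]
  simp only [dualPairing, Prod.smul_fst, Prod.smul_snd, PiLp.smul_apply, smul_eq_mul,
    key _ (contDiff_fst_apply hφ _), key _ (contDiff_snd_apply hφ _)]
  ring

end Pairing

section Cutoff

/-- A smooth cutoff of the unit interval. -/
def intervalCutoff (n t : ℝ) : ℝ := Real.smoothTransition (n * (t * (1 - t)) - 1)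

/-- A smooth cutoff of the unit square. -/
def squareCutoff (n : ℝ) (x : Plane) : ℝ := intervalCutoff n (x 0) * intervalCutoff n (x 1)

theorem contDiff_intervalCutoff (n : ℝ) : ContDiff ℝ 1 (intervalCutoff n) :=
  Real.smoothTransition.contDiff.comp
    ((contDiff_const.mul (contDiff_id.mul (contDiff_const.sub contDiff_id))).sub contDiff_const)

theorem contDiff_squareCutoff (n : ℝ) : ContDiff ℝ 1 (squareCutoff n) := by
  have h : ∀ i : Fin 2, ContDiff ℝ 1 fun x : Plane => intervalCutoff n (x i) := fun i =>
    (contDiff_intervalCutoff n).comp (contDiff_euclidean.1 contDiff_id i)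
  exact (h 0).mul (h 1)

theorem intervalCutoff_nonneg (n t : ℝ) : 0 ≤ intervalCutoff n t :=
  Real.smoothTransition.nonneg _

theorem intervalCutoff_le_one (n t : ℝ) : intervalCutoff n t ≤ 1 :=
  Real.smoothTransition.le_one _

theorem squareCutoff_nonneg (n : ℝ) (x : Plane) : 0 ≤ squareCutoff n x :=
  mul_nonneg (intervalCutoff_nonneg _ _) (intervalCutoff_nonneg _ _)

theorem squareCutoff_le_one (n : ℝ) (x : Plane) : squareCutoff n x ≤ 1 :=
  mul_le_one₀ (intervalCutoff_le_one _ _) (intervalCutoff_nonneg _ _) (intervalCutoff_le_one _ _)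

theorem two_lt_mul_of_mem_Ioo {n t : ℝ} (hn : 0 < n) (ht : t ∈ Ioo (4 / n) (1 - 4 / n)) :
    2 < n * (t * (1 - t)) := by
  obtain ⟨h1, h2⟩ := ht
  have h2' : 4 / n < 1 - t := by linarith
  have h0 : 0 < 4 / n := by positivity
  have h1' : 4 < n * t := by rwa [div_lt_iff₀' hn] at h1
  have h2'' : 4 < n * (1 - t) := by rwa [div_lt_iff₀' hn] at h2'
  rcases le_total t (1 / 2) with h | h
  · nlinarith
  · nlinarith

theorem tsupport_squareCutoff_subset {n : ℝ} (hn : 0 < n) :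
    tsupport (squareCutoff n) ⊆ unitSq := by
  have hc : IsClosed {x : Plane | ∀ i, 1 ≤ n * (x i * (1 - x i))} := by
    simp only [ofPred_forall]
    exact isClosed_iInter fun i => isClosed_le continuous_const (by fun_prop)
  have hs : Function.support (squareCutoff n) ⊆ {x : Plane | ∀ i, 1 ≤ n * (x i * (1 - x i))} := by
    intro x hx
    obtain ⟨h0, h1⟩ := mul_ne_zero_iff.1 hx
    have key : ∀ t, intervalCutoff n t ≠ 0 → 1 ≤ n * (t * (1 - t)) := by
      intro t ht
      by_contra! h
      exact ht (Real.smoothTransition.zero_of_nonpos (by linarith))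
    exact Fin.forall_fin_two.2 ⟨key _ h0, key _ h1⟩
  refine (closure_minimal hs hc).trans fun x hx => ?_
  rw [unitSq_eq_openBox]
  intro i
  have h : 0 < x i * (1 - x i) := by
    by_contra! h
    have := hx i
    nlinarith
  constructor
  · by_contra! h'
    nlinarith
  · by_contra! h'
    nlinarith

theorem exists_abs_deriv_smoothTransition_le :
    ∃ C, 0 ≤ C ∧ (∀ t, |deriv Real.smoothTransition t| ≤ C) ∧
      ∀ t, 1 < t → deriv Real.smoothTransition t = 0 := by
  have hpos : ∀ t, 1 < t → deriv Real.smoothTransition t = 0 := by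
    intro t ht
    have h : Real.smoothTransition =ᶠ[nhds t] fun _ => 1 := by
      filter_upwards [lt_mem_nhds ht] with s hs
      exact Real.smoothTransition.one_of_one_le hs.le
    rw [h.deriv_eq, deriv_const]
  have hneg : ∀ t < 0, deriv Real.smoothTransition t = 0 := by
    intro t ht
    have h : Real.smoothTransition =ᶠ[nhds t] fun _ => 0 := by
      filter_upwards [gt_mem_nhds ht] with s hs
      exact Real.smoothTransition.zero_of_nonpos hs.le
    rw [h.deriv_eq, deriv_const]
  have hc : Continuous (deriv Real.smoothTransition) :=
    (Real.smoothTransition.contDiff (n := 1)).continuous_deriv le_rfl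
  obtain ⟨C, hC⟩ := (isCompact_Icc (a := (0 : ℝ)) (b := 1)).exists_bound_of_continuousOn
    hc.continuousOn
  have hC0 : 0 ≤ C := (norm_nonneg _).trans (hC 0 (by simp))
  refine ⟨C, hC0, fun t => ?_, hpos⟩
  by_cases ht : t ∈ Icc (0 : ℝ) 1
  · exact hC t ht
  · have : deriv Real.smoothTransition t = 0 := by
      rcases lt_or_ge t 0 with h | h
      · exact hneg t h
      · exact hpos t (by_contra fun h' => ht ⟨h, not_lt.1 h'⟩)
    rw [this, abs_zero]
    exact hC0

theorem hasDerivAt_intervalCutoff (n t : ℝ) :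
    HasDerivAt (intervalCutoff n)
      (deriv Real.smoothTransition (n * (t * (1 - t)) - 1) * (n * (1 - 2 * t))) t := by
  have h1 : HasDerivAt (fun t : ℝ => n * (t * (1 - t)) - 1) (n * (1 - 2 * t)) t := by
    have := (((hasDerivAt_id t).mul ((hasDerivAt_id t).const_sub 1)).const_mul n).sub_const 1
    convert! this using 1
    simp only [id]
    ring
  exact ((Real.smoothTransition.contDiff (n := 1)).differentiable one_ne_zero
    _).hasDerivAt.comp t h1

theorem fderiv_squareCutoff (n : ℝ) (x : Plane) :
    fderiv ℝ (squareCutoff n) x (e2 0) =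
        deriv (intervalCutoff n) (x 0) * intervalCutoff n (x 1) ∧
      fderiv ℝ (squareCutoff n) x (e2 1) =
        intervalCutoff n (x 0) * deriv (intervalCutoff n) (x 1) := by
  have h : ∀ i : Fin 2, HasFDerivAt (fun x : Plane => intervalCutoff n (x i))
      (deriv (intervalCutoff n) (x i) • (EuclideanSpace.proj i : Plane →L[ℝ] ℝ)) x := fun i =>
    HasDerivAt.comp_hasFDerivAt (h₂ := intervalCutoff n) (f := fun x : Plane => x i) x
      ((contDiff_intervalCutoff n).differentiable one_ne_zero (x i)).hasDerivAt
      (EuclideanSpace.proj i : Plane →L[ℝ] ℝ).hasFDerivAt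
  have h' : fderiv ℝ (squareCutoff n) x = _ := ((h 0).mul (h 1)).fderiv
  rw [h']
  constructor <;> simp [e2, mul_comm]

theorem exists_abs_fderiv_squareCutoff_le :
    ∃ C, 0 ≤ C ∧ ∀ n : ℝ, 0 < n →
      (∀ x ∈ unitSq, ∀ i, |fderiv ℝ (squareCutoff n) x (e2 i)| ≤ C * n) ∧
      ∀ x ∈ openBox (4 / n) (1 - 4 / n), ∀ i, fderiv ℝ (squareCutoff n) x (e2 i) = 0 := by
  obtain ⟨C, hC0, hC, hz⟩ := exists_abs_deriv_smoothTransition_le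
  refine ⟨C, hC0, fun n hn => ⟨fun x hx => ?_, fun x hx => ?_⟩⟩
  · have hd : ∀ i, |deriv (intervalCutoff n) (x i)| ≤ C * n := by
      intro i
      rw [unitSq_eq_openBox] at hx
      obtain ⟨h0, h1⟩ := hx i
      rw [(hasDerivAt_intervalCutoff n _).deriv, abs_mul, abs_mul, abs_of_pos hn]
      have : |1 - 2 * x i| ≤ 1 := abs_le.2 ⟨by linarith, by linarith⟩
      exact mul_le_mul (hC _) (mul_le_of_le_one_right hn.le this) (by positivity) hC0
    have hη : ∀ i, |intervalCutoff n (x i)| ≤ 1 := fun i => by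
      rw [abs_of_nonneg (intervalCutoff_nonneg _ _)]
      exact intervalCutoff_le_one _ _
    refine Fin.forall_fin_two.2 ⟨?_, ?_⟩
    · rw [(fderiv_squareCutoff n x).1, abs_mul]
      exact (mul_le_of_le_one_right (abs_nonneg _) (hη 1)).trans (hd 0)
    · rw [(fderiv_squareCutoff n x).2, abs_mul]
      exact (mul_le_of_le_one_left (abs_nonneg _) (hη 0)).trans (hd 1)
  · have hd : ∀ i, deriv (intervalCutoff n) (x i) = 0 := by
      intro i
      have := two_lt_mul_of_mem_Ioo hn (hx i)
      rw [(hasDerivAt_intervalCutoff n _).deriv, hz _ (by linarith), zero_mul]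
    refine Fin.forall_fin_two.2 ⟨?_, ?_⟩
    · rw [(fderiv_squareCutoff n x).1, hd, zero_mul]
    · rw [(fderiv_squareCutoff n x).2, hd, mul_zero]

theorem tendsto_squareCutoff {x : Plane} (hx : x ∈ unitSq) :
    Filter.Tendsto (fun n : ℕ => squareCutoff n x) Filter.atTop (nhds 1) := by
  rw [unitSq_eq_openBox] at hx
  have key : ∀ i, ∀ᶠ n : ℕ in Filter.atTop, intervalCutoff n (x i) = 1 := by
    intro i
    have hpos : 0 < x i * (1 - x i) := mul_pos (hx i).1 (by linarith [(hx i).2])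
    have h := (tendsto_natCast_atTop_atTop (R := ℝ)).atTop_mul_const hpos
    filter_upwards [h.eventually_ge_atTop 2] with n hn
    exact Real.smoothTransition.one_of_one_le (by linarith)
  refine tendsto_const_nhds.congr' ?_
  filter_upwards [key 0, key 1] with n h0 h1
  rw [squareCutoff, h0, h1, mul_one]

end Cutoff

section Extension

variable {φ : Plane → Plane × Plane} {u : Plane → Plane}

theorem eventually_abs_le_near_boundary (hu : Continuous u) (h0 : ∀ x ∉ unitSq, u x = 0)
    {ω : ℝ} (hω : 0 < ω) :
    ∀ᶠ n : ℕ in Filter.atTop, ∀ x ∈ unitSq \ openBox (4 / n) (1 - 4 / n), ∀ i, |u x i| ≤ ω := by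
  have hs : HasCompactSupport u :=
    HasCompactSupport.intro isCompact_closure_unitSq fun x hx =>
      h0 x fun h => hx (subset_closure h)
  obtain ⟨δ, hδ, huc⟩ :=
    Metric.uniformContinuous_iff.1 (hs.uniformContinuous_of_continuous hu) ω hω
  have hlim : Filter.Tendsto (fun n : ℕ => 4 / (n : ℝ)) Filter.atTop (nhds 0) :=
    tendsto_const_div_atTop_nhds_zero_nat 4
  filter_upwards [hlim.eventually_lt_const hδ] with n hn x hx i
  obtain ⟨y, hy, hxy⟩ : ∃ y ∉ unitSq, dist x y < δ := by
    obtain ⟨hxQ, hxb⟩ := hx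
    simp only [openBox, mem_ofPred_eq, not_forall] at hxb
    obtain ⟨j, hj⟩ := hxb
    rw [unitSq_eq_openBox] at hxQ ⊢
    obtain ⟨hj0, hj1⟩ := hxQ j
    have key : ∀ t : ℝ, t ∉ Ioo (0 : ℝ) 1 → |x j - t| < δ →
        ∃ y ∉ openBox 0 1, dist x y < δ := by
      intro t ht hd
      refine ⟨x - EuclideanSpace.single j (x j - t), fun h => ht ?_, ?_⟩
      · simpa using h j
      · simpa [dist_eq_norm] using hd
    by_cases hl : x j ≤ 4 / n
    · exact key 0 (by simp) (by rw [sub_zero, abs_of_pos hj0]; linarith)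
    · refine key 1 (by simp) ?_
      have hr : 1 - 4 / n ≤ x j := by
        by_contra! h
        exact hj ⟨not_le.1 hl, h⟩
      rw [abs_sub_comm, abs_of_pos (by linarith)]
      linarith
  have := huc hxy
  rw [h0 y hy, dist_zero_right] at this
  exact (PiLp.norm_apply_le (u x) i).trans this.le

theorem measureReal_unitSq_diff_le {n : ℝ} (hn : 8 ≤ n) :
    volume.real (unitSq \ openBox (4 / n) (1 - 4 / n)) ≤ 16 / n := by
  have hn0 : 0 < n := by linarith
  have h : 8 / n ≤ 1 := (div_le_one hn0).2 hn
  have e : 8 / n = 2 * (4 / n) := by ring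
  have h4 : 0 < 4 / n := by positivity
  have hsub : openBox (4 / n) (1 - 4 / n) ⊆ openBox 0 1 :=
    openBox_subset_openBox h4.le (by linarith)
  rw [unitSq_eq_openBox, measureReal_sdiff hsub (isOpen_openBox _ _).measurableSet
      (by rw [volume_openBox]; finiteness),
    measureReal_openBox zero_le_one, measureReal_openBox (by linarith)]
  have e' : 16 / n = 4 * (4 / n) := by ring
  rw [e']
  nlinarith

/-- The derivatives of the cutoffs do not contribute in the limit, when paired with a map
vanishing on the boundary. -/
theorem tendsto_integral_cutoff_remainder (hu : Continuous u) (h0 : ∀ x ∉ unitSq, u x = 0)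
    (h1 : BoundedByOne φ) :
    Filter.Tendsto (fun n : ℕ => ∫ x in unitSq,
      ((u x 0) * (fderiv ℝ (squareCutoff n) x (e2 0) * (φ x).1 0 +
          fderiv ℝ (squareCutoff n) x (e2 1) * (φ x).1 1) +
        (u x 1) * (fderiv ℝ (squareCutoff n) x (e2 0) * (φ x).2 0 +
          fderiv ℝ (squareCutoff n) x (e2 1) * (φ x).2 1))) Filter.atTop (nhds 0) := by
  obtain ⟨C, hC0, hC⟩ := exists_abs_fderiv_squareCutoff_le
  rw [Metric.tendsto_nhds]
  intro ε hε
  set ω : ℝ := ε / (64 * C + 1) with hω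
  have hωpos : 0 < ω := by positivity
  filter_upwards [eventually_abs_le_near_boundary hu h0 hωpos, Filter.eventually_ge_atTop 8]
    with n hn hn8
  have hn8' : (8 : ℝ) ≤ n := by exact_mod_cast hn8
  have hnpos : (0 : ℝ) < n := by linarith
  obtain ⟨hCn, hzero⟩ := hC n hnpos
  have hfin : volume (unitSq \ openBox (4 / (n : ℝ)) (1 - 4 / n)) < ∞ :=
    (measure_mono sdiff_subset).trans_lt volume_unitSq_lt_top
  rw [setIntegral_eq_of_subset_of_forall_sdiff_eq_zero isOpen_unitSq.measurableSet
    (sdiff_subset (s := unitSq) (t := openBox (4 / (n : ℝ)) (1 - 4 / n)))]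
  · rw [dist_zero_right]
    have hbound : ∀ x ∈ unitSq \ openBox (4 / (n : ℝ)) (1 - 4 / n),
        ‖(u x 0) * (fderiv ℝ (squareCutoff n) x (e2 0) * (φ x).1 0 +
          fderiv ℝ (squareCutoff n) x (e2 1) * (φ x).1 1) +
        (u x 1) * (fderiv ℝ (squareCutoff n) x (e2 0) * (φ x).2 0 +
          fderiv ℝ (squareCutoff n) x (e2 1) * (φ x).2 1)‖ ≤ 4 * ω * (C * n) := by
      intro x hx
      have hu' := hn x hx
      have hd := hCn x hx.1
      have term : ∀ i j (b : ℝ), |b| ≤ 1 →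
          |u x i * (fderiv ℝ (squareCutoff n) x (e2 j) * b)| ≤ ω * (C * n) := by
        intro i j b hb
        rw [abs_mul, abs_mul]
        exact mul_le_mul (hu' i)
          ((mul_le_of_le_one_right (abs_nonneg _) hb).trans (hd j)) (by positivity) hωpos.le
      have t1 := term 0 0 _ (h1 x 0).1
      have t2 := term 0 1 _ (h1 x 1).1
      have t3 := term 1 0 _ (h1 x 0).2
      have t4 := term 1 1 _ (h1 x 1).2
      rw [Real.norm_eq_abs, mul_add, mul_add]
      refine (abs_add_le _ _).trans ?_
      refine (add_le_add (abs_add_le _ _) (abs_add_le _ _)).trans ?_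
      linarith
    refine (norm_setIntegral_le_of_norm_le_const hfin hbound).trans_lt ?_
    calc 4 * ω * (C * n) * volume.real (unitSq \ openBox (4 / (n : ℝ)) (1 - 4 / n))
        ≤ 4 * ω * (C * n) * (16 / n) := by
          gcongr
          exact measureReal_unitSq_diff_le hn8'
      _ = 64 * C * ω := by field_simp; ring
      _ < (64 * C + 1) * ω := by linarith
      _ = ε := by rw [hω]; field_simp
  · intro x hx
    have hxb : x ∈ openBox (4 / (n : ℝ)) (1 - 4 / n) := by
      by_contra h
      exact hx.2 ⟨hx.1, h⟩
    simp [hzero x hxb]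

/-- For a map equal to the identity outside the unit square, the bound by the variation holds
for test fields that do not vanish near the boundary. -/
theorem setIntegral_dualPairing_sub_id_le_of_boundary {F : Plane → Plane} (hF : Continuous F)
    (hid : EqOn F id unitSqᶜ) (hB : BddAbove (varSet F unitSq)) (hφ : ContDiff ℝ 1 φ)
    (h1 : BoundedByOne φ) :
    ∫ x in unitSq, dualPairing (fun y => F y - y) φ x ≤
      Var F unitSq + ∫ x in unitSq, fieldTrace φ x := by
  set u : Plane → Plane := fun y => F y - y
  have hu : Continuous u := hF.sub continuous_id'
  have hu0 : ∀ x ∉ unitSq, u x = 0 := fun x hx => sub_eq_zero.2 (hid hx)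
  have hsmul : ∀ n : ℕ, ContDiff ℝ 1 fun y => squareCutoff n y • φ y := fun n =>
    (contDiff_squareCutoff n).smul hφ
  have hP := continuous_dualPairing hφ hu
  have hT := continuous_fieldTrace hφ
  have hχ := fun n : ℕ => (contDiff_squareCutoff n).continuous
  have hlim : ∀ a : Plane → ℝ, Continuous a → Filter.Tendsto
      (fun n : ℕ => ∫ x in unitSq, squareCutoff n x * a x) Filter.atTop
      (nhds (∫ x in unitSq, a x)) := by
    intro a ha
    refine tendsto_integral_of_dominated_convergence (fun x => |a x|)
      (fun n => ((hχ n).mul ha).aestronglyMeasurable) ha.abs.integrableOn_unitSq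
      (fun n => Filter.Eventually.of_forall fun x => ?_) ?_
    · rw [Real.norm_eq_abs, abs_mul, abs_of_nonneg (squareCutoff_nonneg _ _)]
      exact mul_le_of_le_one_left (abs_nonneg _) (squareCutoff_le_one _ _)
    · filter_upwards [ae_restrict_mem isOpen_unitSq.measurableSet] with x hx
      simpa using (tendsto_squareCutoff hx).mul_const (a x)
  have hR := tendsto_integral_cutoff_remainder hu hu0 h1
  have hL := (hlim _ hP).add hR
  rw [add_zero] at hL
  refine le_of_tendsto_of_tendsto hL ((hlim _ hT).const_add (Var F unitSq)) ?_
  filter_upwards [Filter.eventually_gt_atTop 0] with n hn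
  have hnpos : (0 : ℝ) < n := by exact_mod_cast hn
  have hsupp : tsupport (fun y => squareCutoff n y • φ y) ⊆ unitSq :=
    (tsupport_smul_subset_left _ _).trans (tsupport_squareCutoff_subset hnpos)
  have hcs : HasCompactSupport fun y => squareCutoff n y • φ y :=
    isCompact_closure_unitSq.of_isClosed_subset (isClosed_tsupport _)
      (hsupp.trans subset_closure)
  have hb : BoundedByOne fun y => squareCutoff n y • φ y := by
    intro x i
    have key : ∀ b : ℝ, |b| ≤ 1 → |squareCutoff n x * b| ≤ 1 := by
      intro b hb
      rw [abs_mul, abs_of_nonneg (squareCutoff_nonneg _ _)]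
      exact mul_le_one₀ (squareCutoff_le_one _ _) (abs_nonneg _) hb
    exact ⟨key _ (h1 x i).1, key _ (h1 x i).2⟩
  have main := setIntegral_dualPairing_sub_id_le hF hB (hsmul n) hcs hsupp hb
  have e : ∀ x, fieldTrace (fun y => squareCutoff n y • φ y) x =
      squareCutoff n x * fieldTrace φ x := by
    intro x
    simp [fieldTrace, mul_add]
  simp only [e] at main
  refine le_of_eq_of_le ?_ main
  rw [← integral_add]
  · exact integral_congr_ae (Filter.Eventually.of_forall fun x =>
      (dualPairing_smul (contDiff_squareCutoff n) hφ x).symm)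
  · exact ((hχ n).mul hP).integrableOn_unitSq
  · have hd := fun i => continuous_fderiv_apply_const (contDiff_squareCutoff (n : ℝ)) (e2 i)
    have c1 := fun i => (contDiff_fst_apply hφ i).continuous
    have c2 := fun i => (contDiff_snd_apply hφ i).continuous
    have cu : ∀ i, Continuous fun x => u x i := fun i => by fun_prop
    exact (((cu 0).mul (((hd 0).mul (c1 0)).add ((hd 1).mul (c1 1)))).add
      ((cu 1).mul (((hd 0).mul (c2 0)).add ((hd 1).mul (c2 1))))).integrableOn_unitSq

end Extension

section Dilation

variable {φ : Plane → Plane × Plane} {F f : Plane → Plane} {r : ℝ}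

open scoped Pointwise in
theorem smul_unitSq (hr : 0 < r) : r • unitSq = openBox 0 r := by
  ext x
  rw [mem_smul_set_iff_inv_smul_mem₀ hr.ne', inv_smul_mem_unitSq hr]

theorem setIntegral_openBox_eq (hr : 0 < r) (a : Plane → ℝ) :
    ∫ x in openBox 0 r, a x = r ^ 2 * ∫ x in unitSq, a (r • x) := by
  rw [Measure.setIntegral_comp_smul_of_pos volume a unitSq hr, smul_unitSq hr,
    finrank_euclideanSpace_fin, smul_eq_mul, mul_inv_cancel_left₀ (by positivity)]

theorem dualPairing_dilate_sub_id (hr : r ≠ 0) (x : Plane) :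
    dualPairing (fun y => dilate r F y - y) φ (r • x) =
      dualPairing (fun y => F y - y) (fun y => φ (r • y)) x := by
  have key : ∀ (a : Plane → ℝ) (e : Plane),
      fderiv ℝ (fun y => a (r • y)) x e = r * fderiv ℝ a (r • x) e := by
    intro a e
    rw [fderiv_comp_smul]
    rfl
  simp only [dualPairing, key (fun y => (φ y).1 0), key (fun y => (φ y).1 1),
    key (fun y => (φ y).2 0), key (fun y => (φ y).2 1), dilate, inv_smul_smul₀ hr, PiLp.sub_apply, PiLp.smul_apply, smul_eq_mul]
  ring

/-- A bound for the variation of the dilation of a map which is the identity outside the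
unit square. -/
theorem le_of_mem_varSet_dilate (hr : 0 < r) (hr1 : r ≤ 1) (hF : Continuous F)
    (hid : EqOn F id unitSqᶜ) (hB : BddAbove (varSet F unitSq)) {v : ℝ}
    (hv : v ∈ varSet (dilate r F) unitSq) :
    v ≤ r ^ 2 * Var F unitSq + 2 * (1 - r ^ 2) := by
  obtain ⟨φ, hφ, hs, hsupp, h1, rfl⟩ := hv
  have h1' : BoundedByOne fun y => φ (r • y) := fun x i => h1 (r • x) i
  have hψ : ContDiff ℝ 1 fun y => φ (r • y) := hφ.comp (contDiff_const_smul r)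
  have hsub := openBox_subset_unitSq hr1
  have hT := (continuous_fieldTrace hφ).integrableOn_unitSq
  have hsplit : ∫ x in unitSq, dualPairing (dilate r F) φ x =
      (∫ x in unitSq, dualPairing (fun y => dilate r F y - y) φ x) -
        ∫ x in unitSq, fieldTrace φ x := by
    simp only [dualPairing_sub]
    rw [integral_sub (continuous_dualPairing hφ (continuous_dilate r hF)).integrableOn_unitSq
      (continuous_dualPairing hφ continuous_id').integrableOn_unitSq,
      setIntegral_dualPairing_id hφ hs hsupp]
    ring
  have hloc : ∫ x in unitSq, dualPairing (fun y => dilate r F y - y) φ x =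
      r ^ 2 * ∫ x in unitSq, dualPairing (fun y => F y - y) (fun y => φ (r • y)) x := by
    rw [setIntegral_eq_of_subset_of_forall_sdiff_eq_zero isOpen_unitSq.measurableSet hsub,
      setIntegral_openBox_eq hr]
    · simp only [dualPairing_dilate_sub_id hr.ne']
    · intro x hx
      simp [dualPairing, dilate_eq_self hr hid hx.2]
  have hbound := mul_le_mul_of_nonneg_left
    (setIntegral_dualPairing_sub_id_le_of_boundary hF hid hB hψ h1') (sq_nonneg r)
  have htrace : r ^ 2 * ∫ x in unitSq, fieldTrace (fun y => φ (r • y)) x =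
      ∫ x in openBox 0 r, fieldTrace φ x := (setIntegral_openBox_eq hr (fieldTrace φ)).symm
  have hdiff := setIntegral_sdiff (isOpen_openBox 0 r).measurableSet hT hsub
  have hmeas : volume.real (unitSq \ openBox 0 r) = 1 - r ^ 2 := by
    rw [measureReal_sdiff hsub (isOpen_openBox _ _).measurableSet
      volume_unitSq_lt_top.ne, unitSq_eq_openBox,
      measureReal_openBox zero_le_one, measureReal_openBox hr.le]
    ring
  have hcorner := norm_setIntegral_le_of_norm_le_const (μ := volume)
    (s := unitSq \ openBox 0 r) (f := fieldTrace φ) (C := 2)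
    ((measure_mono sdiff_subset).trans_lt volume_unitSq_lt_top)
    fun x _ => abs_fieldTrace_le h1 x
  rw [hmeas, Real.norm_eq_abs] at hcorner
  have := neg_abs_le (∫ x in unitSq \ openBox 0 r, fieldTrace φ x)
  change ∫ x in unitSq, dualPairing (dilate r F) φ x ≤ _
  rw [hsplit, hloc]
  linarith

theorem varSet_congr {U : Set Plane} (hU : MeasurableSet U) (h : EqOn F f U) :
    varSet F U = varSet f U := by
  have key : ∀ φ, ∫ x in U, dualPairing F φ x = ∫ x in U, dualPairing f φ x := fun φ =>
    setIntegral_congr_fun hU fun x hx => by simp only [dualPairing, h hx]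
  ext v
  constructor
  · rintro ⟨φ, hφ, hs, hsupp, h1, rfl⟩
    exact ⟨φ, hφ, hs, hsupp, h1, key φ⟩
  · rintro ⟨φ, hφ, hs, hsupp, h1, rfl⟩
    exact ⟨φ, hφ, hs, hsupp, h1, (key φ).symm⟩

theorem varSet_nonempty (F : Plane → Plane) (U : Set Plane) : (varSet F U).Nonempty :=
  ⟨_, 0, contDiff_const, HasCompactSupport.zero, by simp [tsupport], by simp, rfl⟩

end Dilation

/-- a `BV` homeomorphism of the open unit square fixing the boundary, with
variation larger than `2`, can be approximated arbitrarily well (uniformly, together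
with its inverse) by `BV` homeomorphisms fixing the boundary with strictly smaller
variation. -/
theorem decrease_variation (f finv : Plane → Plane)
    (hf : IsHomeoOn f finv unitSq unitSq) (hext : ExtendsToId f)
    (hBV : IsBV f unitSq) (hVar : 2 < Var f unitSq) (ε : ℝ) (hε : 0 < ε) :
    ∃ g ginv : Plane → Plane,
      IsHomeoOn g ginv unitSq unitSq ∧ ExtendsToId g ∧ IsBV g unitSq ∧
      supDist g f unitSq + supDist ginv finv unitSq < ε ∧
      Var g unitSq < Var f unitSq := by
  obtain ⟨H, hHf, hHfinv, hid⟩ := exists_homeomorph_extension hf hext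
  have hε3 : 0 < ε / 3 := by positivity
  have hclose := (eventually_supDist_dilate_le H.continuous hHf hε3).and
    (eventually_supDist_dilate_le H.symm.continuous hHfinv hε3)
  obtain ⟨r, ⟨⟨hd, hd'⟩, hr⟩, hr1⟩ := (((hclose.and (lt_mem_nhds one_pos)).filter_mono
    nhdsWithin_le_nhds).and (self_mem_nhdsWithin (s := Iio 1))).exists
  have hset := varSet_congr isOpen_unitSq.measurableSet hHf
  have hB : BddAbove (varSet H unitSq) := hset ▸ hBV.2
  have hV : Var H unitSq = Var f unitSq := congrArg sSup hset
  have hle := fun v (hv : v ∈ varSet (dilate r H) unitSq) =>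
    le_of_mem_varSet_dilate hr (le_of_lt hr1) H.continuous hid hB hv
  refine ⟨dilate r H, dilate r H.symm, isHomeoOn_dilate hr (le_of_lt hr1) H hid,
    extendsToId_dilate hr (le_of_lt hr1) H.continuous hid,
    ⟨(continuous_dilate r H.continuous).integrableOn_unitSq, _, hle⟩, by linarith,
    (csSup_le (varSet_nonempty _ _) hle).trans_lt ?_⟩
  rw [hV]
  have hsq : r ^ 2 < 1 := pow_lt_one₀ hr.le hr1 two_ne_zero
  nlinarith

end
end
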